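/- arXiv:2604.15928 — 2 statements merged into one kernel-verified Lean document; each statement's English description precedes it below -/
import Mathlib

section
/- Let F be a field of characteristic 2 and n ≥ 1. Suppose ω ∈ K₂(F)/2ⁿK₂(F) is such that its lift (under the standard embedding) to K₂(F)/2^{n+1}K₂(F) is a sum of two symbols {α,β}_{2^{n+1}} + {γ,δ}_{2^{n+1}} with {α,β}_{2^{n+1}} ≠ 0 of exponent dividing 2ⁿ. Then ω is a sum of at most 5 symbols in K₂(F)/2ⁿK₂(F). -/
namespace Milnor

variable (F : Type*) [Field F]

/-- Relations defining the Milnor K-group `K_n(F)`: multiplicativity in each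
slot and the Steinberg relation. -/
def rels (n : ℕ) : AddSubgroup (FreeAbelianGroup (Fin n → Fˣ)) :=
  AddSubgroup.closure
    ({ x | ∃ (i : Fin n) (u v w : Fin n → Fˣ),
        (∀ j, j ≠ i → u j = v j ∧ u j = w j) ∧ w i = u i * v i ∧
        x = FreeAbelianGroup.of w - FreeAbelianGroup.of u - FreeAbelianGroup.of v } ∪
     { x | ∃ (i j : Fin n) (u : Fin n → Fˣ), i ≠ j ∧ (u i : F) + (u j : F) = 1 ∧
        x = FreeAbelianGroup.of u })

/-- The Milnor K-group `K_n(F)`. -/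
def K (n : ℕ) := FreeAbelianGroup (Fin n → Fˣ) ⧸ rels F n

instance (n : ℕ) : AddCommGroup (K F n) :=
  QuotientAddGroup.Quotient.addCommGroup _

/-- The subgroup `2^m K_n(F)` of `K_n(F)`. -/
def modSub (n m : ℕ) : AddSubgroup (K F n) :=
  AddSubgroup.closure { x | ∃ y : K F n, x = (2 ^ m) • y }

/-- The quotient `K_n(F)/2^m K_n(F)`. -/
def KMod (n m : ℕ) := K F n ⧸ modSub F n m

instance (n m : ℕ) : AddCommGroup (KMod F n m) :=
  QuotientAddGroup.Quotient.addCommGroup _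

variable {F}

/-- The class of the symbol `{v 0, …, v (n-1)}` in `K_n(F)/2^m K_n(F)`. -/
def symbol {n : ℕ} (m : ℕ) (v : Fin n → Fˣ) : KMod F n m :=
  QuotientAddGroup.mk (QuotientAddGroup.mk (FreeAbelianGroup.of v) : K F n)

open scoped Classical in
/-- `{a,b}` in `K₂(F)/2^m K₂(F)` for field elements, with junk value `0` if an
entry vanishes.  So `s2 1 a b` is `{a,b}₂` and `s2 2 a b` is `{a,b}₄`. -/
noncomputable def s2 (m : ℕ) (a b : F) : KMod F 2 m :=
  if h : a ≠ 0 ∧ b ≠ 0 then symbol m ![Units.mk0 a h.1, Units.mk0 b h.2] else 0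

open scoped Classical in
/-- `{a,b,c,d}` in `K₄(F)/2^m K₄(F)` for field elements, junk value `0`. -/
noncomputable def s4 (m : ℕ) (a b c d : F) : KMod F 4 m :=
  if h : a ≠ 0 ∧ b ≠ 0 ∧ c ≠ 0 ∧ d ≠ 0 then
    symbol m ![Units.mk0 a h.1, Units.mk0 b h.2.1, Units.mk0 c h.2.2.1, Units.mk0 d h.2.2.2]
  else 0

end Milnor

open Milnor



namespace Milnor

section API
variable {F : Type*} [Field F]

/-- The class of the symbol in `K₂(F)`. -/
def sy (a b : Fˣ) : K F 2 := QuotientAddGroup.mk (FreeAbelianGroup.of ![a, b])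

theorem sy_mul_left (a a' b : Fˣ) : sy (a * a') b = sy a b + sy a' b := by
  have h : FreeAbelianGroup.of ![a * a', b] - FreeAbelianGroup.of ![a, b] -
      FreeAbelianGroup.of ![a', b] ∈ rels F 2 := by
    apply AddSubgroup.subset_closure
    left
    refine ⟨0, ![a, b], ![a', b], ![a * a', b], ?_, by simp, rfl⟩
    intro j hj
    fin_cases j <;> simp_all
  have h2 := (QuotientAddGroup.eq_zero_iff (N := rels F 2) _).2 h
  have h3 : sy (a * a') b - sy a b - sy a' b = 0 := h2
  rw [sub_sub, sub_eq_zero] at h3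
  exact h3

theorem sy_mul_right (a b b' : Fˣ) : sy a (b * b') = sy a b + sy a b' := by
  have h : FreeAbelianGroup.of ![a, b * b'] - FreeAbelianGroup.of ![a, b] -
      FreeAbelianGroup.of ![a, b'] ∈ rels F 2 := by
    apply AddSubgroup.subset_closure
    left
    refine ⟨1, ![a, b], ![a, b'], ![a, b * b'], ?_, by simp, rfl⟩
    intro j hj
    fin_cases j <;> simp_all
  have h2 := (QuotientAddGroup.eq_zero_iff (N := rels F 2) _).2 h
  have h3 : sy a (b * b') - sy a b - sy a b' = 0 := h2
  rw [sub_sub, sub_eq_zero] at h3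
  exact h3

theorem sy_steinberg (a b : Fˣ) (h : (a : F) + b = 1) : sy a b = 0 := by
  refine (QuotientAddGroup.eq_zero_iff (N := rels F 2) _).2 ?_
  apply AddSubgroup.subset_closure
  right
  exact ⟨0, 1, ![a, b], by simp, by simpa using h, rfl⟩

theorem sy_one_left (b : Fˣ) : sy 1 b = 0 := by
  have := sy_mul_left 1 1 b
  simpa using this

theorem sy_one_right (b : Fˣ) : sy b 1 = 0 := by
  have := sy_mul_right b 1 1
  simpa using this

theorem sy_inv_left (a b : Fˣ) : sy a⁻¹ b = - sy a b := by
  have := sy_mul_left a⁻¹ a b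
  rw [inv_mul_cancel, sy_one_left] at this
  exact eq_neg_of_add_eq_zero_left this.symm

theorem sy_inv_right (a b : Fˣ) : sy a b⁻¹ = - sy a b := by
  have := sy_mul_right a b⁻¹ b
  rw [inv_mul_cancel, sy_one_right] at this
  exact eq_neg_of_add_eq_zero_left this.symm

theorem K_induction {P : K F 2 → Prop} (h0 : P 0) (hs : ∀ a b, P (sy a b))
    (hneg : ∀ x, P x → P (-x)) (hadd : ∀ x y, P x → P y → P (x + y)) (x : K F 2) : P x := by
  obtain ⟨z, rfl⟩ := QuotientAddGroup.mk_surjective (s := rels F 2) x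
  induction z using FreeAbelianGroup.induction_on with
  | zero => exact h0
  | of v =>
    have : v = ![v 0, v 1] := by ext i; fin_cases i <;> rfl
    rw [this]; exact hs _ _
  | neg v ih => exact hneg _ ih
  | add x y hx hy => exact hadd _ _ hx hy

/-- Universal property of `K₂`. -/
noncomputable def K2lift {B : Type*} [AddCommGroup B] (c : Fˣ → Fˣ → B)
    (hl : ∀ a a' b, c (a * a') b = c a b + c a' b)
    (hr : ∀ a b b', c a (b * b') = c a b + c a b')
    (hs : ∀ a b : Fˣ, (a : F) + b = 1 → c a b = 0) : K F 2 →+ B :=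
  QuotientAddGroup.lift (rels F 2) (FreeAbelianGroup.lift fun v => c (v 0) (v 1)) (by
    have hanti : ∀ a b : Fˣ, (a : F) + b = 1 → c b a = 0 := fun a b h =>
      hs b a (by rw [add_comm]; exact h)
    rw [rels, AddSubgroup.closure_le]
    rintro x (⟨i, u, v, w, h, hw, rfl⟩ | ⟨i, j, u, hij, h, rfl⟩)
    · simp only [SetLike.mem_coe, AddMonoidHom.mem_ker, map_sub, FreeAbelianGroup.lift_apply_of]
      fin_cases i
      · have := h 1 (by simp)
        simp only [Fin.zero_eta] at hw
        rw [hw, ← this.1, ← this.2, hl]; abel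
      · have := h 0 (by simp)
        simp only [Fin.mk_one] at hw
        rw [hw, ← this.1, ← this.2, hr]; abel
    · simp only [SetLike.mem_coe, AddMonoidHom.mem_ker, FreeAbelianGroup.lift_apply_of]
      fin_cases i <;> fin_cases j
      · simp at hij
      · exact hs _ _ h
      · exact hanti _ _ h
      · simp at hij)

@[simp] theorem K2lift_sy {B : Type*} [AddCommGroup B] (c : Fˣ → Fˣ → B)
    (hl : ∀ a a' b, c (a * a') b = c a b + c a' b)
    (hr : ∀ a b b', c a (b * b') = c a b + c a b')
    (hs : ∀ a b : Fˣ, (a : F) + b = 1 → c a b = 0) (a b : Fˣ) :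
    K2lift c hl hr hs (sy a b) = c a b := by
  change FreeAbelianGroup.lift _ (FreeAbelianGroup.of ![a, b]) = _
  simp

theorem mem_modSub (m : ℕ) (x : K F 2) : x ∈ modSub F 2 m ↔ ∃ y, x = 2 ^ m • y := by
  constructor
  · intro h
    induction h using AddSubgroup.closure_induction with
    | mem x h => exact h
    | zero => exact ⟨0, by simp⟩
    | add x y _ _ hx hy =>
      obtain ⟨a, rfl⟩ := hx
      obtain ⟨b, rfl⟩ := hy
      exact ⟨a + b, by rw [smul_add]⟩
    | neg x _ hx =>
      obtain ⟨a, rfl⟩ := hx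
      exact ⟨-a, by rw [smul_neg]⟩
  · intro h
    exact AddSubgroup.subset_closure h

theorem sy_self [CharP F 2] (a : Fˣ) : sy a a = 0 := by
  by_cases h1 : a = 1
  · rw [h1, sy_one_left]
  have h2 : (1 : F) + a ≠ 0 := by
    intro h
    apply h1
    ext
    have := CharTwo.add_eq_zero.1 h
    simp [← this]
  have h3 : (1 : F) + (a⁻¹ : Fˣ) ≠ 0 := by
    intro h
    apply h1
    have := CharTwo.add_eq_zero.1 h
    have h4 : a⁻¹ = 1 := by ext; simp [← this]
    simpa using h4
  have e1 := sy_steinberg a (Units.mk0 _ h2) (by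
    simp only [Units.val_mk0]; rw [add_comm (1 : F), ← add_assoc, CharTwo.add_self_eq_zero, zero_add])
  have e2 := sy_steinberg a⁻¹ (Units.mk0 _ h3) (by
    rw [Units.val_mk0, add_comm (1 : F), ← add_assoc, CharTwo.add_self_eq_zero, zero_add])
  rw [sy_inv_left, neg_eq_zero] at e2
  have h5 : Units.mk0 _ h2 = a * Units.mk0 _ h3 := by
    ext
    simp [mul_add, add_comm]
  rw [h5, sy_mul_right, e2, add_zero] at e1
  exact e1

theorem sy_comm [CharP F 2] (a b : Fˣ) : sy a b = - sy b a := by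
  have := sy_self (a * b)
  rw [sy_mul_left, sy_mul_right, sy_mul_right, sy_self, sy_self, zero_add, add_zero] at this
  exact eq_neg_of_add_eq_zero_left this

end API

/-- `K₂` mod 2. -/
abbrev V (F : Type*) [Field F] := KMod F 2 1

set_option linter.unusedSectionVars false

section modtwo
variable {F : Type*} [Field F] [CharP F 2]

theorem V_two (v : V F) : v + v = 0 := by
  obtain ⟨x, rfl⟩ := QuotientAddGroup.mk_surjective (s := modSub F 2 1) v
  refine (QuotientAddGroup.eq_zero_iff (N := modSub F 2 1) (x + x)).2 ?_
  rw [mem_modSub]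
  exact ⟨x, by rw [pow_one, two_smul]⟩

/-- The symbol mod 2 with junk value zero. -/
noncomputable abbrev s (a b : F) : V F := s2 1 a b

theorem s_def {a b : F} (ha : a ≠ 0) (hb : b ≠ 0) :
    s a b = (QuotientAddGroup.mk (sy (Units.mk0 a ha) (Units.mk0 b hb)) : V F) := by
  unfold s s2
  rw [dif_pos ⟨ha, hb⟩]; rfl

theorem s_zero_left (b : F) : s 0 b = 0 := by simp [s, s2]
theorem s_zero_right (b : F) : s b 0 = 0 := by simp [s, s2]

theorem s_mul_left {a a' : F} (b : F) (ha : a ≠ 0) (ha' : a' ≠ 0) :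
    s (a * a') b = s a b + s a' b := by
  by_cases hb : b = 0
  · simp [hb, s_zero_right]
  rw [s_def (mul_ne_zero ha ha') hb, s_def ha hb, s_def ha' hb, Units.mk0_mul, sy_mul_left]
  rfl

theorem s_mul_right (a : F) {b b' : F} (hb : b ≠ 0) (hb' : b' ≠ 0) :
    s a (b * b') = s a b + s a b' := by
  by_cases ha : a = 0
  · simp [ha, s_zero_left]
  rw [s_def ha (mul_ne_zero hb hb'), s_def ha hb, s_def ha hb', Units.mk0_mul, sy_mul_right]
  rfl

theorem s_self (a : F) : s a a = 0 := by
  by_cases ha : a = 0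
  · simp [ha, s_zero_left]
  rw [s_def ha ha, sy_self]; rfl

theorem s_comm (a b : F) : s a b = s b a := by
  by_cases ha : a = 0
  · simp [ha, s_zero_left, s_zero_right]
  by_cases hb : b = 0
  · simp [hb, s_zero_left, s_zero_right]
  rw [s_def ha hb, s_def hb ha, sy_comm]
  exact (eq_neg_of_add_eq_zero_left
    (V_two (QuotientAddGroup.mk (sy (Units.mk0 b hb) (Units.mk0 a ha)) : V F))).symm

theorem s_sq_left (a b : F) : s (a ^ 2) b = 0 := by
  by_cases ha : a = 0
  · simp [ha, s_zero_left]
  rw [pow_two, s_mul_left _ ha ha, V_two]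

theorem s_sq_right (a b : F) : s a (b ^ 2) = 0 := by
  rw [s_comm, s_sq_left]

theorem s_steinberg {a b : F} (h : a + b = 1) : s a b = 0 := by
  by_cases ha : a = 0
  · simp [ha, s_zero_left]
  by_cases hb : b = 0
  · simp [hb, s_zero_right]
  rw [s_def ha hb, sy_steinberg _ _ (by simpa using h)]; rfl

theorem s_inv_right (a b : F) : s a b⁻¹ = s a b := by
  by_cases hb : b = 0
  · simp [hb]
  have h := s_mul_right a (pow_ne_zero 2 hb) (inv_ne_zero hb)
  have h1 : s a (b ^ 2) = 0 := by rw [pow_two, s_mul_right _ hb hb, V_two]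
  rw [h1, zero_add] at h
  rw [← h]; congr 1; field_simp

/-- `{x,y} = {x+y, xy}`. -/
theorem s_add (x y : F) (hx : x ≠ 0) (hy : y ≠ 0) : s x y = s (x + y) (x * y) := by
  by_cases hxy : x + y = 0
  · rw [hxy, s_zero_left, CharTwo.add_eq_zero.1 hxy, s_self]
  have h := s_steinberg (a := x * (x + y)⁻¹) (b := y * (x + y)⁻¹) (by field_simp)
  have hi := inv_ne_zero hxy
  rw [s_mul_left _ hx hi, s_mul_right _ hy hi, s_mul_right _ hy hi, s_self, add_zero,
    s_inv_right, s_comm (x + y)⁻¹, s_inv_right, s_comm y, s_comm x (x+y), add_assoc,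
    ← s_mul_right _ hx hy] at h
  have h2 := V_two (s (x + y) (x * y))
  exact (add_right_cancel (h.trans h2.symm))

/-- `{x, x+y} = {x,y} + {y, x+y}`. -/
theorem s_add' (x y : F) (hx : x ≠ 0) (hy : y ≠ 0) : s x (x + y) = s x y + s y (x + y) := by
  rw [s_add x y hx hy, s_mul_right _ hx hy, s_comm x, s_comm y, add_assoc, V_two, add_zero]

end modtwo
end Milnor


namespace Milnor
set_option linter.unusedSectionVars false
section forms
variable {F : Type*} [Field F] [CharP F 2]

/-- Adjoining `a` to a subfield containing all squares. -/
def ext (k : Subfield F) (hk : ∀ x : F, x ^ 2 ∈ k) (a : F) : Subfield F where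
  carrier := {x | ∃ u ∈ k, ∃ v ∈ k, x = u + v * a}
  mul_mem' := by
    rintro _ _ ⟨u, hu, v, hv, rfl⟩ ⟨u', hu', v', hv', rfl⟩
    exact ⟨u * u' + v * v' * a ^ 2, k.add_mem (k.mul_mem hu hu')
      (k.mul_mem (k.mul_mem hv hv') (hk a)), u * v' + v * u',
      k.add_mem (k.mul_mem hu hv') (k.mul_mem hv hu'), by ring⟩
  one_mem' := ⟨1, k.one_mem, 0, k.zero_mem, by simp⟩
  add_mem' := by
    rintro _ _ ⟨u, hu, v, hv, rfl⟩ ⟨u', hu', v', hv', rfl⟩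
    exact ⟨u + u', k.add_mem hu hu', v + v', k.add_mem hv hv', by ring⟩
  zero_mem' := ⟨0, k.zero_mem, 0, k.zero_mem, by simp⟩
  neg_mem' := by
    rintro _ ⟨u, hu, v, hv, rfl⟩
    exact ⟨-u, k.neg_mem hu, -v, k.neg_mem hv, by ring⟩
  inv_mem' := by
    rintro x ⟨u, hu, v, hv, rfl⟩
    refine ⟨u * ((u + v * a)⁻¹) ^ 2, k.mul_mem hu (hk _), v * ((u + v * a)⁻¹) ^ 2,
      k.mul_mem hv (hk _), ?_⟩
    by_cases h : u + v * a = 0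
    · simp [h]
    · field_simp

theorem mem_ext {k : Subfield F} {hk : ∀ x : F, x ^ 2 ∈ k} {a x : F} :
    x ∈ ext k hk a ↔ ∃ u ∈ k, ∃ v ∈ k, x = u + v * a := Iff.rfl

theorem le_ext (k : Subfield F) (hk : ∀ x : F, x ^ 2 ∈ k) (a : F) : k ≤ ext k hk a :=
  fun u hu => ⟨u, hu, 0, k.zero_mem, by simp⟩

theorem self_mem_ext (k : Subfield F) (hk : ∀ x : F, x ^ 2 ∈ k) (a : F) : a ∈ ext k hk a :=
  ⟨0, k.zero_mem, 1, k.one_mem, by simp⟩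

theorem ext_le {k N : Subfield F} {hk : ∀ x : F, x ^ 2 ∈ k} {a : F} (h : k ≤ N) (ha : a ∈ N) :
    ext k hk a ≤ N := by
  rintro _ ⟨u, hu, v, hv, rfl⟩
  exact N.add_mem (h hu) (N.mul_mem (h hv) ha)

theorem ext_rel {k : Subfield F} {hk : ∀ x : F, x ^ 2 ∈ k} {a a1 a2 : F}
    (h1 : a1 ∈ ext k hk a) (h2 : a2 ∈ ext k hk a) (h1' : a1 ∉ k) (h2' : a2 ∉ k) :
    ∃ v ∈ k, ∃ c ∈ k, v ≠ 0 ∧ a2 = v * (a1 + c) := by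
  obtain ⟨p, hp, q, hq, rfl⟩ := h1
  obtain ⟨p', hp', q', hq', rfl⟩ := h2
  have hq0 : q ≠ 0 := by rintro rfl; simp at h1'; exact h1' hp
  have hq0' : q' ≠ 0 := by rintro rfl; simp at h2'; exact h2' hp'
  refine ⟨q' / q, k.div_mem hq' hq, -p + p' * q / q', k.add_mem (k.neg_mem hp)
    (k.div_mem (k.mul_mem hp' hq) hq'), div_ne_zero hq0' hq0, ?_⟩
  field_simp
  ring

section key
variable {B : Type*} [AddCommGroup B] (φ : V F →+ B) (k N L : Subfield F)
  (hk : ∀ x : F, x ^ 2 ∈ k) (a0 : F)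

theorem tz (h1 : ∀ c ∈ k, ∀ l ∈ L, φ (s c l) = 0)
    {z v w : F} (hkL : k ≤ L) (hz : z ∈ L) (hz0 : z ≠ 0) (hv : v ∈ k) (hw : w ∈ k) :
    φ (s z (v + w * z)) = 0 := by
  by_cases hw0 : w = 0
  · rw [hw0, zero_mul, add_zero, s_comm]; exact h1 _ hv _ hz
  by_cases hv0 : v = 0
  · rw [hv0, zero_add, s_mul_right _ hw0 hz0, s_self, add_zero, s_comm]; exact h1 _ hw _ hz
  have hL : w * z + v ∈ L := L.add_mem (L.mul_mem (hkL hw) hz) (hkL hv)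
  have e := s_add' (w * z) v (mul_ne_zero hw0 hz0) hv0
  rw [s_mul_left _ hw0 hz0, s_comm _ v] at e
  have e2 := congrArg φ e
  rw [map_add, map_add, h1 _ hw _ hL, h1 _ hv _ hL, h1 _ hv _ (L.mul_mem (hkL hw) hz), zero_add,
    add_zero] at e2
  rw [add_comm]; exact e2

theorem single (h1 : ∀ c ∈ k, ∀ l ∈ L, φ (s c l) = 0)
    (hkN : k ≤ N) (hNL : N ≤ L) {z y0 y1 : F} (hz : z ∈ L) (hzN : z ∉ N)
    (ha0 : a0 ∈ N)
    (hy0 : y0 ∈ ext k hk a0) (hy1 : y1 ∈ ext k hk a0) :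
    ∃ a' ∈ ext k hk a0, ∃ b' ∈ L, φ (s z (y0 + y1 * z)) = φ (s a' b') := by
  have hkL := hkN.trans hNL
  have hz0 : z ≠ 0 := by rintro rfl; exact hzN N.zero_mem
  have hK'N : ext k hk a0 ≤ N := ext_le hkN ha0
  have hzero : φ (s 0 0) = 0 := by rw [s_zero_left, map_zero]
  by_cases hY : y0 + y1 * z = 0
  · exact ⟨0, Subfield.zero_mem _, 0, Subfield.zero_mem _, by rw [hY, s_zero_right, s_zero_right]⟩
  have key : ∃ v ∈ k, ∃ w ∈ k, (v + w * z ≠ 0) ∧ ∃ H ∈ ext k hk a0, ∃ u ∈ k,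
      (v + w * z) * (y0 + y1 * z) = H + u * z := by
    have hne : ∀ v ∈ k, ∀ w ∈ k, (v ≠ 0 ∨ w ≠ 0) → v + w * z ≠ 0 := by
      intro v hv w hw h h0
      by_cases hw0 : w = 0
      · simp [hw0] at h0 h; exact h h0
      · apply hzN
        have : z = - v / w := by field_simp; linear_combination h0
        rw [this]
        exact N.div_mem (N.neg_mem (hkN hv)) (hkN hw)
    obtain ⟨p, hp, q, hq, rfl⟩ := hy0
    obtain ⟨p', hp', q', hq', rfl⟩ := hy1
    by_cases hqq : q = 0 ∧ q' = 0
    · refine ⟨1, k.one_mem, 0, k.zero_mem, by simp, p, le_ext _ _ _ hp, p', hp', ?_⟩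
      rw [hqq.1, hqq.2]; ring
    · refine ⟨q, hq, q', hq', hne _ hq _ hq' (by tauto), q * (p + q * a0) +
        q' * (p' + q' * a0) * z ^ 2, ?_, q * p' + q' * p,
        k.add_mem (k.mul_mem hq hp') (k.mul_mem hq' hp), ?_⟩
      · have hm := le_ext k hk a0
        have ha := self_mem_ext k hk a0
        exact Subfield.add_mem _ (Subfield.mul_mem _ (hm hq) (Subfield.add_mem _ (hm hp)
          (Subfield.mul_mem _ (hm hq) ha))) (Subfield.mul_mem _ (Subfield.mul_mem _ (hm hq')
          (Subfield.add_mem _ (hm hp') (Subfield.mul_mem _ (hm hq') ha))) (hm (hk z)))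
      · linear_combination (q * q' * a0 * z) * (CharTwo.two_eq_zero (R := F))
  obtain ⟨v, hv, w, hw, hvw, H, hH, u, hu, e⟩ := key
  have e1 : φ (s z (y0 + y1 * z)) = φ (s z (H + u * z)) := by
    rw [← e, s_mul_right _ hvw hY, map_add, tz φ k L h1 hkL hz hz0 hv hw, zero_add]
  have hE0 : H + u * z ≠ 0 := by rw [← e]; exact mul_ne_zero hvw hY
  rw [e1]
  by_cases hu0 : u = 0
  · exact ⟨H, hH, z, hz, by rw [hu0, zero_mul, add_zero, s_comm]⟩
  by_cases hH0 : H = 0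
  · refine ⟨0, Subfield.zero_mem _, 0, Subfield.zero_mem _, ?_⟩
    rw [hH0, hzero]
    exact tz φ k L h1 hkL hz hz0 k.zero_mem hu
  have hHL : H ∈ L := hNL (hK'N hH)
  have huz : u * z ∈ L := L.mul_mem (hkL hu) hz
  refine ⟨H, hH, u * z * (u * z + H), L.mul_mem huz (L.add_mem huz hHL), ?_⟩
  have huz0 := mul_ne_zero hu0 hz0
  have f := s_add' (u * z) H huz0 hH0
  rw [s_mul_left _ hu0 hz0] at f
  have f2 := congrArg φ f
  rw [map_add, h1 _ hu _ (L.add_mem huz hHL), zero_add, s_comm (u * z) H,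
    ← s_mul_right _ huz0 (by rw [add_comm]; exact hE0)] at f2
  rw [add_comm H]
  exact f2


theorem two_term (h1 : ∀ c ∈ k, ∀ l ∈ L, φ (s c l) = 0)
    (h2 : ∀ n ∈ N, ∀ n' ∈ N, φ (s n n') = 0)
    (hN : ∀ x : F, x ^ 2 ∈ N) (hkN : k ≤ N) (ha0 : a0 ∈ N) (b0 : F)
    (hL : L = ext N hN b0)
    {a1 a2 b1 b2 : F}
    (ha1 : a1 ∈ ext k hk a0) (ha2 : a2 ∈ ext k hk a0) (hb1 : b1 ∈ L) (hb2 : b2 ∈ L) :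
    ∃ a' ∈ ext k hk a0, ∃ b' ∈ L, φ (s a1 b1) + φ (s a2 b2) = φ (s a' b') := by
  have hNL : N ≤ L := by rw [hL]; exact le_ext _ _ _
  have hkL := hkN.trans hNL
  have hK'N : ext k hk a0 ≤ N := ext_le hkN ha0
  by_cases c1 : a1 ∈ k
  · exact ⟨a2, ha2, b2, hb2, by rw [h1 _ c1 _ hb1, zero_add]⟩
  by_cases c2 : a2 ∈ k
  · exact ⟨a1, ha1, b1, hb1, by rw [h1 _ c2 _ hb2, add_zero]⟩
  by_cases c3 : b1 ∈ N
  · exact ⟨a2, ha2, b2, hb2, by rw [h2 _ (hK'N ha1) _ c3, zero_add]⟩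
  by_cases c4 : b2 ∈ N
  · exact ⟨a1, ha1, b1, hb1, by rw [h2 _ (hK'N ha2) _ c4, add_zero]⟩
  obtain ⟨v, hv, c, hc, hv0, rfl⟩ := ext_rel ha1 ha2 c1 c2
  obtain ⟨v', hv', n, hn, hv0', rfl⟩ := ext_rel (hL ▸ hb1) (hL ▸ hb2) c3 c4
  have hac0 : a1 + c ≠ 0 := by intro h; rw [h, mul_zero] at c2; exact c2 k.zero_mem
  have hbn0 : b1 + n ≠ 0 := by intro h; rw [h, mul_zero] at c4; exact c4 N.zero_mem
  have ha10 : a1 ≠ 0 := by rintro rfl; exact c1 k.zero_mem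
  have hb10 : b1 ≠ 0 := by rintro rfl; exact c3 N.zero_mem
  have hm := le_ext k hk a0
  have hbnL : b1 + n ∈ L := L.add_mem hb1 (hNL hn)
  have hacK : a1 + c ∈ ext k hk a0 := Subfield.add_mem _ ha1 (hm hc)
  have e1 : φ (s (v * (a1 + c)) (v' * (b1 + n))) = φ (s (a1 + c) (b1 + n)) := by
    rw [s_mul_left _ hv0 hac0, map_add, h1 _ hv _ hb2, zero_add, s_mul_right _ hv0' hbn0, map_add,
      h2 _ (hK'N hacK) _ hv', zero_add]
  rw [e1]
  by_cases hc0 : c = 0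
  · refine ⟨a1, ha1, b1 * (b1 + n), L.mul_mem hb1 hbnL, ?_⟩
    rw [hc0, add_zero, s_mul_right _ hb10 hbn0, map_add]
  by_cases hn0 : n = 0
  · refine ⟨a1 * (a1 + c), Subfield.mul_mem _ ha1 hacK, b1, hb1, ?_⟩
    rw [hn0, add_zero, s_mul_left _ ha10 hac0, map_add]
  have hn1 : c / n ∈ N := N.div_mem (hkN hc) hn
  have hn10 : c / n ≠ 0 := div_ne_zero hc0 hn0
  have f1 : φ (s a1 b1) = φ (s (a1 + c / n * b1) (a1 * (c / n * b1))) := by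
    rw [← s_add _ _ ha10 (mul_ne_zero hn10 hb10), s_mul_right _ hn10 hb10, map_add,
      h2 _ (hK'N ha1) _ hn1, zero_add]
  have hzz : (a1 + c) + c / n * (b1 + n) = a1 + c / n * b1 := by
    field_simp
    linear_combination (c * n) * (CharTwo.two_eq_zero (R := F))
  have f2 : φ (s (a1 + c) (b1 + n)) =
      φ (s (a1 + c / n * b1) ((a1 + c) * (c / n * (b1 + n)))) := by
    rw [← hzz, ← s_add _ _ hac0 (mul_ne_zero hn10 hbn0), s_mul_right _ hn10 hbn0, map_add,
      h2 _ (hK'N hacK) _ hn1, zero_add]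
  rw [f1, f2, ← map_add, ← s_mul_right _ (mul_ne_zero ha10 (mul_ne_zero hn10 hb10))
    (mul_ne_zero hac0 (mul_ne_zero hn10 hbn0))]
  have hzL : a1 + c / n * b1 ∈ L := L.add_mem (hNL (hK'N ha1)) (L.mul_mem (hNL hn1) hb1)
  have hzN : a1 + c / n * b1 ∉ N := by
    intro h
    apply c3
    have : b1 = (a1 + c / n * b1 - a1) / (c / n) := by field_simp; ring
    rw [this]
    exact N.div_mem (N.sub_mem h (hK'N ha1)) hn1
  have hk1 : a1 ^ 2 / c ∈ k := k.div_mem (hk _) hc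
  have hk2 : b1 ^ 2 * c / n ^ 2 ∈ k := k.div_mem (k.mul_mem (hk _) hc) (hk _)
  have hy1 : c ^ 2 * (a1 + a1 ^ 2 / c) ∈ ext k hk a0 :=
    Subfield.mul_mem _ (hm (hk c)) (Subfield.add_mem _ ha1 (hm hk1))
  have hy0 : c ^ 2 * (a1 + a1 ^ 2 / c) * (a1 + b1 ^ 2 * c / n ^ 2) ∈ ext k hk a0 :=
    Subfield.mul_mem _ hy1 (Subfield.add_mem _ ha1 (hm hk2))
  have hfin := single φ k N L hk a0 h1 hkN hNL hzL hzN ha0 hy0 hy1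
  have hid : a1 * (c / n * b1) * ((a1 + c) * (c / n * (b1 + n))) =
      c ^ 2 * (a1 + a1 ^ 2 / c) * (a1 + b1 ^ 2 * c / n ^ 2) +
        c ^ 2 * (a1 + a1 ^ 2 / c) * (a1 + c / n * b1) := by
    have h2' := CharTwo.two_eq_zero (R := F)
    field_simp
    linear_combination (-(n ^ 2 * a1 * (c + a1))) * h2'
  rw [hid]
  exact hfin
end key
end forms
end Milnor


namespace Milnor
set_option linter.unusedSectionVars false
section ders
variable {F : Type*} [Field F] [CharP F 2]

theorem exists_der (N : Subfield F) (hN : ∀ x : F, x ^ 2 ∈ N) (e : F) (he : e ∉ N) :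
    ∃ D : Derivation ℤ F F, (∀ n ∈ N, D n = 0) ∧ D e ≠ 0 := by
  obtain ⟨G, hNG, hG⟩ := zorn_le_nonempty₀ {G : Subfield F | N ≤ G ∧ e ∉ G} (by
    intro c hc hch y hy
    have hdir : DirectedOn (· ≤ ·) c := hch.directedOn
    refine ⟨sSup c, ⟨(hc hy).1.trans (le_sSup hy), ?_⟩, fun z hz => le_sSup hz⟩
    intro h
    obtain ⟨G, hGc, hG⟩ := (Subfield.mem_sSup_of_directedOn ⟨y, hy⟩ hdir).1 h
    exact (hc hGc).2 hG) N ⟨le_refl _, he⟩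
  have heG : e ∉ G := hG.prop.2
  have hsq : ∀ x : F, x ^ 2 ∈ G := fun x => hNG (hN x)
  have key : ∀ x : F, ∃ u v : F, u ∈ G ∧ v ∈ G ∧ x = u + v * e := by
    intro x
    by_cases hx : x ∈ G
    · exact ⟨x, 0, hx, G.zero_mem, by simp⟩
    by_cases hex : e ∈ ext G hsq x
    · obtain ⟨u, hu, v, hv, h⟩ := hex
      have hv0 : v ≠ 0 := by rintro rfl; rw [zero_mul, add_zero] at h; exact heG (h ▸ hu)
      refine ⟨-u / v, 1 / v, G.div_mem (G.neg_mem hu) hv, G.div_mem G.one_mem hv, ?_⟩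
      field_simp
      linear_combination -h
    · exfalso
      have := hG.le_of_ge (y := ext G hsq x) ⟨hNG.trans (le_ext _ _ _), hex⟩ (le_ext _ _ _)
      exact hx (this (self_mem_ext _ _ _))
  have uniq : ∀ u v u' v' : F, u ∈ G → v ∈ G → u' ∈ G → v' ∈ G → u + v * e = u' + v' * e →
      v = v' := by
    intro u v u' v' hu hv hu' hv' h
    by_contra hne
    have h0 : v - v' ≠ 0 := sub_ne_zero.2 hne
    apply heG
    have : e = (u' - u) / (v - v') := by field_simp; linear_combination h
    rw [this]
    exact G.div_mem (G.sub_mem hu' hu) (G.sub_mem hv hv')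
  choose p q hp hq hpq using key
  have hqu : ∀ x u v, u ∈ G → v ∈ G → x = u + v * e → q x = v := by
    intro x u v hu hv h
    exact uniq _ _ _ _ (hp x) (hq x) hu hv ((hpq x).symm.trans h)
  let D0 : F →+ F :=
    { toFun := q
      map_zero' := hqu _ 0 0 G.zero_mem G.zero_mem (by simp)
      map_add' := fun x y => hqu _ (p x + p y) _ (G.add_mem (hp x) (hp y))
        (G.add_mem (hq x) (hq y)) (by linear_combination hpq x + hpq y) }
  refine ⟨Derivation.mk' D0.toIntLinearMap ?_, ?_, ?_⟩
  · intro a b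
    change q (a * b) = a * q b + b * q a
    have h1 : q (a * b) = p a * q b + p b * q a := by
      refine hqu _ (p a * p b + q a * q b * e ^ 2) _ ?_ ?_ ?_
      · exact G.add_mem (G.mul_mem (hp a) (hp b)) (G.mul_mem (G.mul_mem (hq a) (hq b)) (hsq e))
      · exact G.add_mem (G.mul_mem (hp a) (hq b)) (G.mul_mem (hp b) (hq a))
      · conv_lhs => rw [hpq a, hpq b]
        ring
    rw [h1]
    linear_combination (-q b) * hpq a - q a * hpq b - (q a * q b * e) * CharTwo.two_eq_zero (R := F)
  · intro n hn
    exact hqu n n 0 (hNG hn) G.zero_mem (by simp)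
  · have : q e = 1 := hqu e 0 1 G.zero_mem G.one_mem (by simp)
    change q e ≠ 0
    rw [this]; exact one_ne_zero

/-- The form `(D₁ ∧ D₂)(dlog ∧ dlog)` on `K₂`. -/
noncomputable def fK (D1 D2 : Derivation ℤ F F) : K F 2 →+ F :=
  K2lift (fun a b => (D1 a * D2 b - D2 a * D1 b) / (a * b))
    (by
      intro a a' b
      have := a.ne_zero; have := a'.ne_zero; have := b.ne_zero
      simp only [Units.val_mul, Derivation.leibniz, smul_eq_mul]
      field_simp
      ring)
    (by
      intro a b b'
      have := a.ne_zero; have := b'.ne_zero; have := b.ne_zero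
      simp only [Units.val_mul, Derivation.leibniz, smul_eq_mul]
      field_simp
      ring)
    (by
      intro a b h
      have hb : (b : F) = 1 - a := by rw [← h]; ring
      rw [hb, map_sub, map_sub, Derivation.map_one_eq_zero, Derivation.map_one_eq_zero]
      ring)

theorem fK_sy (D1 D2 : Derivation ℤ F F) (a b : Fˣ) :
    fK D1 D2 (sy a b) = (D1 a * D2 b - D2 a * D1 b) / (a * b) := K2lift_sy _ _ _ _ _ _

theorem fK_two (D1 D2 : Derivation ℤ F F) (x : K F 2) : fK D1 D2 (2 • x) = 0 := by
  rw [map_nsmul, two_smul, CharTwo.add_self_eq_zero]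

/-- The form on `K₂` mod 2. -/
noncomputable def fV (D1 D2 : Derivation ℤ F F) : V F →+ F :=
  QuotientAddGroup.lift (modSub F 2 1) (fK D1 D2) (by
    intro x hx
    obtain ⟨y, rfl⟩ := (mem_modSub _ _).1 hx
    rw [pow_one]
    exact fK_two _ _ _)

theorem fV_mk (D1 D2 : Derivation ℤ F F) (x : K F 2) :
    fV D1 D2 (QuotientAddGroup.mk x : V F) = fK D1 D2 x := rfl

theorem fV_s (D1 D2 : Derivation ℤ F F) (a b : F) :
    fV D1 D2 (s a b) = (D1 a * D2 b - D2 a * D1 b) / (a * b) := by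
  by_cases ha : a = 0
  · simp [ha, s_zero_left]
  by_cases hb : b = 0
  · simp [hb, s_zero_right]
  rw [s_def ha hb, fV_mk, fK_sy]; rfl

/-- All forms vanish. -/
def FZ (v : V F) : Prop := ∀ D1 D2 : Derivation ℤ F F, fV D1 D2 v = 0

/-- Symbols with entries in `N`. -/
def WW (k L : Subfield F) : AddSubgroup (V F) :=
  AddSubgroup.closure {v | ∃ a ∈ k, ∃ b ∈ L, v = s a b}

theorem s_mem_WW {k L : Subfield F} {a b : F} (ha : a ∈ k) (hb : b ∈ L) : s a b ∈ WW k L :=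
  AddSubgroup.subset_closure ⟨a, ha, b, hb, rfl⟩

theorem WW_mono {k k' L L' : Subfield F} (h : k ≤ k') (h' : L ≤ L') : WW k L ≤ WW k' L' := by
  apply AddSubgroup.closure_mono
  rintro _ ⟨a, ha, b, hb, rfl⟩
  exact ⟨a, h ha, b, h' hb, rfl⟩

theorem stepT (k N : Subfield F) (hk : ∀ x : F, x ^ 2 ∈ k) (hN : ∀ x : F, x ^ 2 ∈ N)
    (hkN : k ≤ N) (a b : F) (ha : a ∈ N)
    (H : ∀ v ∈ WW N N ⊔ WW k (ext N hN b), FZ v → v = 0) :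
    ∀ v ∈ WW N N ⊔ WW (ext k hk a) (ext N hN b), FZ v → v = 0 := by
  intro v hv hz
  set L := ext N hN b with hL
  set G := WW N N ⊔ WW k L with hG
  let φ : V F →+ V F ⧸ G := QuotientAddGroup.mk' G
  have hNL : N ≤ L := le_ext _ _ _
  have hkL := hkN.trans hNL
  have hK'N : ext k hk a ≤ N := ext_le hkN ha
  have φ0 : ∀ x, φ x = 0 ↔ x ∈ G := fun x => QuotientAddGroup.eq_zero_iff x
  have h1 : ∀ c ∈ k, ∀ l ∈ L, φ (s c l) = 0 := fun c hc l hl =>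
    (φ0 _).2 ((le_sup_right : _ ≤ G) (s_mem_WW hc hl))
  have h2 : ∀ n ∈ N, ∀ n' ∈ N, φ (s n n') = 0 := fun c hc l hl =>
    (φ0 _).2 ((le_sup_left : _ ≤ G) (s_mem_WW hc hl))
  have hneg : ∀ x : V F, -x = x := fun x => neg_eq_of_add_eq_zero_left (V_two x)
  have hsing : ∃ a' ∈ ext k hk a, ∃ b' ∈ L, φ v = φ (s a' b') := by
    obtain ⟨x, hx, y, hy, rfl⟩ := AddSubgroup.mem_sup.1 hv
    have hφx : φ x = 0 := (φ0 _).2 ((le_sup_left : _ ≤ G) hx)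
    have : ∃ a' ∈ ext k hk a, ∃ b' ∈ L, φ y = φ (s a' b') := by
      clear hv hz
      induction hy using AddSubgroup.closure_induction with
      | mem y h =>
        obtain ⟨a', ha', b', hb', rfl⟩ := h
        exact ⟨a', ha', b', hb', rfl⟩
      | zero => exact ⟨0, Subfield.zero_mem _, 0, Subfield.zero_mem _, by rw [s_zero_left]⟩
      | add x y _ _ hx hy =>
        obtain ⟨a1, ha1, b1, hb1, e1⟩ := hx
        obtain ⟨a2, ha2, b2, hb2, e2⟩ := hy
        rw [map_add, e1, e2]
        exact two_term φ k N L hk a h1 h2 hN hkN ha b hL ha1 ha2 hb1 hb2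
      | neg x _ hx => rw [hneg]; exact hx
    obtain ⟨a', ha', b', hb', e⟩ := this
    exact ⟨a', ha', b', hb', by rw [map_add, hφx, zero_add, e]⟩
  obtain ⟨a', ha', b', hb', e⟩ := hsing
  by_cases c1 : a' ∈ k
  · rw [h1 _ c1 _ hb'] at e
    exact H v ((φ0 _).1 e) hz
  by_cases c2 : b' ∈ N
  · rw [h2 _ (hK'N ha') _ c2] at e
    exact H v ((φ0 _).1 e) hz
  exfalso
  obtain ⟨D1, hD1, hD1'⟩ := exists_der k hk a' c1
  obtain ⟨D2, hD2, hD2'⟩ := exists_der N hN b' c2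
  have hG0 : ∀ x ∈ G, fV D1 D2 x = 0 := by
    have : G ≤ (fV D1 D2).ker := by
      rw [hG]
      refine sup_le ?_ ?_
      · refine (AddSubgroup.closure_le _).2 ?_
        rintro _ ⟨a, ha, b, hb, rfl⟩
        simp only [SetLike.mem_coe, AddMonoidHom.mem_ker]
        rw [fV_s, hD2 _ ha, hD2 _ hb]; simp
      · refine (AddSubgroup.closure_le _).2 ?_
        rintro _ ⟨a, ha, b, hb, rfl⟩
        simp only [SetLike.mem_coe, AddMonoidHom.mem_ker]
        rw [fV_s, hD1 _ ha, hD2 _ (hkN ha)]; simp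
    exact fun x hx => this hx
  have hd : v - s a' b' ∈ G := (φ0 _).1 (by rw [map_sub, e, sub_self])
  have h3 := hG0 _ hd
  rw [map_sub, hz, zero_sub, neg_eq_zero, fV_s, hD2 _ (hK'N ha'), zero_mul, sub_zero] at h3
  have ha0 : a' ≠ 0 := by rintro rfl; exact c1 k.zero_mem
  have hb0 : b' ≠ 0 := by rintro rfl; exact c2 N.zero_mem
  exact (div_ne_zero (mul_ne_zero hD1' hD2') (mul_ne_zero ha0 hb0)) h3

theorem WW_ext (N : Subfield F) (hN : ∀ x : F, x ^ 2 ∈ N) (b : F) :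
    WW (ext N hN b) (ext N hN b) ≤ WW N (ext N hN b) := by
  set L := ext N hN b with hL
  have hNL : N ≤ L := le_ext _ _ _
  refine (AddSubgroup.closure_le _).2 ?_
  rintro _ ⟨x, hx, y, hy, rfl⟩
  simp only [SetLike.mem_coe]
  by_cases hxN : x ∈ N
  · exact s_mem_WW hxN hy
  by_cases hyN : y ∈ N
  · rw [s_comm]; exact s_mem_WW hyN hx
  obtain ⟨v, hv, c, hc, hv0, rfl⟩ := ext_rel hx hy hxN hyN
  have hx0 : x ≠ 0 := by rintro rfl; exact hxN N.zero_mem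
  have hxc : x + c ≠ 0 := by intro h; rw [h, mul_zero] at hyN; exact hyN N.zero_mem
  have hxcL : x + c ∈ L := L.add_mem hx (hNL hc)
  rw [s_mul_right _ hv0 hxc]
  refine add_mem (by rw [s_comm]; exact s_mem_WW hv hx) ?_
  by_cases hc0 : c = 0
  · rw [hc0, add_zero, s_self]; exact zero_mem _
  rw [s_add' _ _ hx0 hc0]
  exact add_mem (by rw [s_comm]; exact s_mem_WW hc hx) (s_mem_WW hc hxcL)

/-- Finitely generated towers over the field of squares. -/
inductive FG : Subfield F → Prop
  | base : FG (frobenius F 2).fieldRange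
  | step (N : Subfield F) (hN : ∀ x : F, x ^ 2 ∈ N) (b : F) : FG N → FG (ext N hN b)

theorem FG.sq {N : Subfield F} (h : FG N) (x : F) : x ^ 2 ∈ N := by
  induction h with
  | base => exact ⟨x, by simp [frobenius_def]⟩
  | step N hN b h ih => exact le_ext _ _ _ ih

theorem base_le {N : Subfield F} (hN : ∀ x : F, x ^ 2 ∈ N) : (frobenius F 2).fieldRange ≤ N := by
  rintro _ ⟨x, rfl⟩
  rw [frobenius_def]; exact hN x

theorem FG.main {N : Subfield F} (h : FG N) : ∀ v ∈ WW N N, FZ v → v = 0 := by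
  have base : ∀ L : Subfield F, WW (frobenius F 2).fieldRange L ≤ ⊥ := by
    intro L
    refine (AddSubgroup.closure_le _).2 ?_
    rintro _ ⟨_, ⟨x, rfl⟩, y, hy, rfl⟩
    simp only [frobenius_def, SetLike.mem_coe, AddSubgroup.mem_bot]
    rw [s_sq_left]
  induction h with
  | base =>
    intro v hv _
    exact base _ hv
  | step N hN b h ih =>
    have inner : ∀ k : Subfield F, FG k → k ≤ N →
        ∀ v ∈ WW N N ⊔ WW k (ext N hN b), FZ v → v = 0 := by
      intro k hk
      induction hk with
      | base =>
        intro _ v hv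
        apply ih
        have hle : WW N N ⊔ WW (frobenius F 2).fieldRange (ext N hN b) ≤ WW N N :=
          sup_le le_rfl ((base _).trans bot_le)
        exact hle hv
      | step k hk a hF ih2 =>
        intro hle
        exact stepT k N hk hN ((le_ext _ _ _).trans hle) a b (hle (self_mem_ext _ _ _))
          (ih2 ((le_ext _ _ _).trans hle))
    intro v hv
    exact inner N h le_rfl v ((le_sup_right : WW N (ext N hN b) ≤ _) (WW_ext N hN b hv))

theorem exists_FG (x : K F 2) : ∀ N : Subfield F, FG N → ∃ N' : Subfield F, FG N' ∧ N ≤ N' ∧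
    (QuotientAddGroup.mk x : V F) ∈ WW N' N' := by
  induction x using K_induction with
  | h0 => exact fun N hN => ⟨N, hN, le_rfl, zero_mem (WW N N)⟩
  | hs a b =>
    intro N hN
    refine ⟨ext (ext N hN.sq a) (FG.step N hN.sq a hN).sq b, FG.step _ _ _ (FG.step _ _ _ hN),
      (le_ext _ _ _).trans (le_ext _ _ _), ?_⟩
    have h := s_mem_WW (le_ext (ext N hN.sq a) (FG.step N hN.sq a hN).sq b
      (self_mem_ext N hN.sq a)) (self_mem_ext (ext N hN.sq a) (FG.step N hN.sq a hN).sq b)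
    rw [s_def a.ne_zero b.ne_zero, Units.mk0_val, Units.mk0_val] at h
    exact h
  | hneg x ih =>
    intro N hN
    obtain ⟨N', h1, h2, h3⟩ := ih N hN
    exact ⟨N', h1, h2, neg_mem h3⟩
  | hadd x y hx hy =>
    intro N hN
    obtain ⟨N', h1, h2, h3⟩ := hx N hN
    obtain ⟨N'', h1', h2', h3'⟩ := hy N' h1
    exact ⟨N'', h1', h2.trans h2', add_mem (WW_mono h2' h2' h3) h3'⟩

/-- `K₂/2` is detected by forms. -/
theorem forms_detect (x : K F 2) (h : ∀ D1 D2 : Derivation ℤ F F, fK D1 D2 x = 0) :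
    ∃ z, x = 2 • z := by
  obtain ⟨N, hN, -, hx⟩ := exists_FG x _ FG.base
  have h0 := hN.main _ hx (fun D1 D2 => by rw [fV_mk, h])
  have := (QuotientAddGroup.eq_zero_iff (N := modSub F 2 1) x).1 h0
  simpa using (mem_modSub 1 x).1 this

end ders
end Milnor


namespace Milnor
set_option linter.unusedSectionVars false
section ps
variable {R : Type*} [CommRing R]

/-- Two-variable power series. -/
abbrev PS (R : Type*) [CommRing R] := MvPowerSeries (Fin 2) R

/-- The Euler operators `x_i ∂/∂x_i`. -/
noncomputable def th (i : Fin 2) : Derivation ℤ (PS R) (PS R) :=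
  Derivation.mk' (R := ℤ) (A := PS R)
    (AddMonoidHom.toIntLinearMap
      { toFun := fun f => ((fun n => (n i : R) * MvPowerSeries.coeff n f : (Fin 2 →₀ ℕ) → R) : PS R)
        map_zero' := by funext n; simp; rfl
        map_add' := by intro f g; funext n; simp [mul_add]; rfl })
    (by
      intro f g
      ext n
      change (n i : R) * MvPowerSeries.coeff n (f * g) = _
      simp only [smul_eq_mul, map_add]
      rw [mul_comm g]
      rw [MvPowerSeries.coeff_mul, MvPowerSeries.coeff_mul, MvPowerSeries.coeff_mul,
        ← Finset.sum_add_distrib, Finset.mul_sum]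
      refine Finset.sum_congr rfl ?_
      rintro ⟨p, q⟩ hpq
      have h : p + q = n := Finset.HasAntidiagonal.mem_antidiagonal.1 hpq
      change (n i : R) * (MvPowerSeries.coeff p f * MvPowerSeries.coeff q g) =
        MvPowerSeries.coeff p f * ((q i : R) * MvPowerSeries.coeff q g) +
          ((p i : R) * MvPowerSeries.coeff p f) * MvPowerSeries.coeff q g
      rw [← h, Finsupp.add_apply]
      push_cast
      ring)

theorem coeff_th (i : Fin 2) (f : PS R) (n : Fin 2 →₀ ℕ) :
    MvPowerSeries.coeff n (th i f) = (n i : R) * MvPowerSeries.coeff n f := rfl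

theorem th_mul (i : Fin 2) (f g : PS R) : th i (f * g) = f * th i g + g * th i f := by
  rw [Derivation.leibniz]; rfl

theorem th_comm (f : PS R) : th 0 (th 1 f) = th 1 (th 0 f) := by
  ext n
  simp only [coeff_th]
  ring

theorem th_map {S : Type*} [CommRing S] (ρ : R →+* S) (i : Fin 2) (f : PS R) :
    th i (MvPowerSeries.map ρ f) = MvPowerSeries.map ρ (th i f) := by
  ext n
  simp [coeff_th]

/-- Series of order at least `k`. -/
def J (R : Type*) [CommRing R] (k : ℕ) : Ideal (PS R) where
  carrier := {f | (k : ℕ∞) ≤ f.order}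
  zero_mem' := by simp
  add_mem' := by
    intro f g hf hg
    exact (le_min hf hg).trans MvPowerSeries.min_order_le_add
  smul_mem' := by
    intro c f hf
    have := MvPowerSeries.le_order_mul (f := c) (g := f)
    exact (le_trans (le_trans hf le_add_self) this)

theorem mem_J {k : ℕ} {f : PS R} : f ∈ J R k ↔ (k : ℕ∞) ≤ f.order := Iff.rfl

theorem mem_J_iff {k : ℕ} {f : PS R} :
    f ∈ J R k ↔ ∀ n : Fin 2 →₀ ℕ, n.degree < k → MvPowerSeries.coeff n f = 0 := by
  constructor
  · intro h n hn
    exact MvPowerSeries.coeff_of_lt_order (lt_of_lt_of_le (by exact_mod_cast hn) (mem_J.1 h))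
  · intro h
    exact MvPowerSeries.nat_le_order h

theorem mul_mem_J {k l : ℕ} {f g : PS R} (hf : f ∈ J R k) (hg : g ∈ J R l) :
    f * g ∈ J R (k + l) := by
  rw [mem_J] at *
  push_cast
  exact (add_le_add hf hg).trans MvPowerSeries.le_order_mul

theorem J_anti {k l : ℕ} (h : k ≤ l) : J R l ≤ J R k := by
  intro f hf
  exact le_trans (by exact_mod_cast h) (mem_J.1 hf)

theorem th_mem_J {k : ℕ} (i : Fin 2) {f : PS R} (hf : f ∈ J R k) : th i f ∈ J R k := by
  rw [mem_J_iff] at *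
  intro n hn
  rw [coeff_th, hf n hn, mul_zero]

theorem map_mem_J {S : Type*} [CommRing S] (ρ : R →+* S) {k : ℕ} {f : PS R} (hf : f ∈ J R k) :
    MvPowerSeries.map ρ f ∈ J S k := by
  rw [mem_J_iff] at *
  intro n hn
  rw [MvPowerSeries.coeff_map, hf n hn, map_zero]

/-- Logarithmic derivative. -/
noncomputable def dl (i : Fin 2) (A : (PS R)ˣ) : PS R := th i (A : PS R) * ((A⁻¹ : (PS R)ˣ) : PS R)

theorem th_eq (i : Fin 2) (A : (PS R)ˣ) : th i (A : PS R) = A * dl i A := by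
  unfold dl
  rw [mul_left_comm, Units.mul_inv, mul_one]

theorem dl_mul (i : Fin 2) (A B : (PS R)ˣ) : dl i (A * B) = dl i A + dl i B := by
  apply A.isUnit.mul_left_cancel
  apply B.isUnit.mul_left_cancel
  have h := th_eq i (A * B)
  rw [Units.val_mul, th_mul, th_eq, th_eq] at h
  linear_combination -h

theorem dl_symm (A : (PS R)ˣ) : th 0 (dl 1 A) = th 1 (dl 0 A) := by
  apply A.isUnit.mul_left_cancel
  have h := th_comm (A : PS R)
  rw [th_eq, th_eq, th_mul, th_mul, th_eq, th_eq] at h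
  linear_combination h

/-- `dlog A ∧ dlog B`. -/
noncomputable def om (A B : (PS R)ˣ) : PS R := dl 0 A * dl 1 B - dl 1 A * dl 0 B

theorem om_mul_left (A A' B : (PS R)ˣ) : om (A * A') B = om A B + om A' B := by
  unfold om; rw [dl_mul, dl_mul]; ring

theorem om_mul_right (A B B' : (PS R)ˣ) : om A (B * B') = om A B + om A B' := by
  unfold om; rw [dl_mul, dl_mul]; ring

theorem om_swap (A B : (PS R)ˣ) : om A B = - om B A := by
  unfold om; ring

theorem om_steinberg (A B : (PS R)ˣ) (h : (A : PS R) + B = 1) : om A B = 0 := by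
  have hB : (B : PS R) = 1 - A := by rw [← h]; ring
  have h1 : ∀ i, (B : PS R) * dl i B = - (A * dl i A) := by
    intro i
    rw [← th_eq, ← th_eq, hB, map_sub, Derivation.map_one_eq_zero, zero_sub]
  apply B.isUnit.mul_left_cancel
  unfold om
  linear_combination dl 0 A * h1 1 - dl 1 A * h1 0

theorem om_map {S : Type*} [CommRing S] (ρ : R →+* S) (A B : (PS R)ˣ) :
    MvPowerSeries.map ρ (om A B) = om (Units.map (MvPowerSeries.map ρ).toMonoidHom A)
      (Units.map (MvPowerSeries.map ρ).toMonoidHom B) := by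
  have h : ∀ (i) (A : (PS R)ˣ), dl i (Units.map (MvPowerSeries.map ρ).toMonoidHom A) =
      MvPowerSeries.map ρ (dl i A) := by
    intro i A
    unfold dl
    rw [map_mul, ← map_inv, Units.coe_map, Units.coe_map]
    simp only [RingHom.toMonoidHom_eq_coe, MonoidHom.coe_coe]
    rw [th_map]
  unfold om
  rw [map_sub, map_mul, map_mul, h, h, h, h]

theorem om_inv_left (A B : (PS R)ˣ) : om A⁻¹ B = - om A B := by
  have h1 : om (1 : (PS R)ˣ) B = 0 := by
    have := om_mul_left 1 1 B
    rw [mul_one] at this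
    exact left_eq_add.1 this
  have := om_mul_left A⁻¹ A B
  rw [inv_mul_cancel, h1] at this
  exact eq_neg_of_add_eq_zero_left this.symm

/-- The exponent `(N,N)`. -/
noncomputable def nn (N : ℕ) : Fin 2 →₀ ℕ := Finsupp.equivFunOnFinite.symm (fun _ => N)

@[simp] theorem nn_apply (N : ℕ) (i : Fin 2) : nn N i = N := rfl

theorem nn_degree (N : ℕ) : (nn N).degree = 2 * N := by
  rw [Finsupp.degree_eq_sum]
  simp [two_mul]

theorem om_one_add_J (N : ℕ) (A B : (PS R)ˣ) (hA : (A : PS R) - 1 ∈ J R (2 * N + 1)) :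
    MvPowerSeries.coeff (nn N) (om A B) = 0 := by
  have h : ∀ i, dl i A ∈ J R (2 * N + 1) := by
    intro i
    have := th_mem_J i hA
    rw [map_sub, Derivation.map_one_eq_zero, sub_zero] at this
    exact Ideal.mul_mem_right _ _ this
  refine (mem_J_iff (k := 2 * N + 1)).1 ?_ _ (by rw [nn_degree]; omega)
  exact Ideal.sub_mem _ (Ideal.mul_mem_right _ _ (h 0)) (Ideal.mul_mem_right _ _ (h 1))

theorem two_pow_aux (m k : ℕ) (x y : R) (h : ((k + 1 : ℕ) : R) * x = 2 ^ m * y) :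
    (2 : R) ^ (m + 1) ∣ 2 ^ (k + 1) * x := by
  obtain ⟨v, o, ho, hk⟩ := Nat.exists_eq_two_pow_mul_odd (n := k + 1) (by omega)
  have hv : v ≤ k := by
    have h1 : 2 ^ v ≤ k + 1 := by
      rw [hk]; exact Nat.le_mul_of_pos_right _ ho.pos
    have h2 : v < 2 ^ v := Nat.lt_two_pow_self
    omega
  have hcop : IsCoprime ((2 : R) ^ (m + 1)) (o : R) := by
    have : IsCoprime ((2 : ℤ) ^ (m + 1)) (o : ℤ) := by
      have h1 : Nat.Coprime (2 ^ (m + 1)) o := (Nat.coprime_two_left.2 ho).pow_left _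
      have := Nat.isCoprime_iff_coprime.2 h1
      simpa using this
    have := this.map (Int.castRingHom R)
    simpa using this
  apply hcop.dvd_of_dvd_mul_left
  obtain ⟨t, ht⟩ := Nat.exists_eq_add_of_le hv
  rw [hk] at h
  push_cast at h
  refine ⟨2 ^ t * y, ?_⟩
  rw [ht]
  linear_combination 2 ^ (t + 1) * h

theorem om_one_add_two (m : ℕ) (A B : (PS R)ˣ) (c : PS R) (hA : (A : PS R) = 1 + 2 * c) :
    (2 : R) ^ (m + 1) ∣ MvPowerSeries.coeff (nn (2 ^ m)) (om A B) := by
  set ℓ := MvPowerSeries.coeff (R := R) (nn (2 ^ m)) with hℓ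
  have hth : ∀ i, (1 + 2 * c) * dl i A = 2 * th i c := by
    intro i
    rw [← hA, ← th_eq, hA, map_add, Derivation.map_one_eq_zero, zero_add, th_mul]
    have : th i (2 : PS R) = 0 := by
      have := Derivation.map_natCast (th (R := R) i) 2
      simpa using this
    rw [this, mul_zero, add_zero]
  set η : PS R := th 0 c * dl 1 B - th 1 c * dl 0 B with hη
  have hcoeff2 : ∀ (j : ℕ) (g : PS R), ℓ (2 ^ j * g) = 2 ^ j * ℓ g := by
    intro j g
    have : (2 : PS R) ^ j * g = (2 ^ j : R) • g := by
      rw [MvPowerSeries.smul_eq_C_mul, map_pow, map_ofNat]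
    rw [this, map_smul, smul_eq_mul]
  have hom : (1 + 2 * c) * om A B = 2 * η := by
    unfold om
    rw [hη]
    linear_combination dl 1 B * hth 0 - dl 0 B * hth 1
  have hexp : om A B = 2 * η * ∑ k ∈ Finset.range (m + 1), (-(2 * c)) ^ k +
      (-(2 * c)) ^ (m + 1) * om A B := by
    have hg := geom_sum_mul (-(2 * c)) (m + 1)
    rw [← hom]
    linear_combination (om A B) * hg
  rw [hexp, map_add]
  refine dvd_add ?_ ?_
  · rw [Finset.mul_sum, map_sum]
    refine Finset.dvd_sum ?_
    intro k _
    have e : 2 * η * (-(2 * c)) ^ k = 2 ^ (k + 1) * ((-1) ^ k * (c ^ k * η)) := by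
      rw [neg_pow, mul_pow]; ring
    rw [e, hcoeff2]
    have hk : ∀ i, th i (c ^ (k + 1)) = ((k + 1 : ℕ) : PS R) * (c ^ k * th i c) := by
      intro i
      rw [Derivation.leibniz_pow]
      simp [nsmul_eq_mul]
    have e2 : ((k + 1 : ℕ) : PS R) * ((-1) ^ k * (c ^ k * η)) =
        th 0 ((-1) ^ k * c ^ (k + 1) * dl 1 B) - th 1 ((-1) ^ k * c ^ (k + 1) * dl 0 B) := by
      have hm : ∀ i, th i ((-1 : PS R) ^ k) = 0 := by
        intro i
        rcases neg_one_pow_eq_or (PS R) k with h | h <;> rw [h]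
        · exact Derivation.map_one_eq_zero _
        · rw [map_neg, Derivation.map_one_eq_zero, neg_zero]
      rw [th_mul, th_mul, th_mul, th_mul, hk, hk, hm, hm, dl_symm, hη]
      ring
    have e3 := congrArg ℓ e2
    have hnat : ∀ (j : ℕ) (g : PS R), ℓ ((j : PS R) * g) = (j : R) * ℓ g := by
      intro j g
      rw [← nsmul_eq_mul, map_nsmul, nsmul_eq_mul]
    rw [hnat, map_sub, hℓ, coeff_th, coeff_th, nn_apply, nn_apply, ← mul_sub] at e3
    rw [Nat.cast_pow, Nat.cast_ofNat] at e3
    exact two_pow_aux m k _ _ e3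
  · have e : (-(2 * c)) ^ (m + 1) * om A B = 2 ^ (m + 1) * ((-1) ^ (m + 1) * c ^ (m + 1) * om A B) := by
      rw [neg_pow, mul_pow]; ring
    rw [e, hcoeff2]
    exact dvd_mul_right _ _

end ps
end Milnor


namespace Milnor
set_option linter.unusedSectionVars false
section charTwo
variable {Q : Type*} [Field Q] [CharP Q 2]

theorem PS_two : (2 : PS Q) = 0 := by
  have h : (2 : PS Q) = MvPowerSeries.C (2 : Q) := (map_ofNat _ 2).symm
  have h2 : (2 : Q) = 0 := CharTwo.two_eq_zero
  exact h.trans ((congrArg _ h2).trans (map_zero _))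

theorem coeff_sq (n : Fin 2 →₀ ℕ) (f : PS Q) :
    MvPowerSeries.coeff (n + n) (f ^ 2) = (MvPowerSeries.coeff n f) ^ 2 := by
  rw [pow_two, MvPowerSeries.coeff_mul, pow_two]
  have hmem : (n, n) ∈ Finset.HasAntidiagonal.antidiagonal (n + n) :=
    Finset.HasAntidiagonal.mem_antidiagonal.2 rfl
  rw [← Finset.add_sum_erase _ _ hmem]
  have : ∑ x ∈ (Finset.HasAntidiagonal.antidiagonal (n + n)).erase (n, n),
      MvPowerSeries.coeff x.1 f * MvPowerSeries.coeff x.2 f = 0 := by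
    refine Finset.sum_involution (fun x _ => x.swap) ?_ ?_ ?_ ?_
    · intro x _
      simp only [Prod.fst_swap, Prod.snd_swap]
      rw [mul_comm, CharTwo.add_self_eq_zero]
    · rintro ⟨p, q⟩ hx _ heq
      simp only [Prod.swap_prod_mk, Prod.mk.injEq] at heq
      obtain ⟨rfl, -⟩ := heq
      rw [Finset.mem_erase, Finset.HasAntidiagonal.mem_antidiagonal] at hx
      apply hx.1
      have h2 : q = n := by
        ext i
        have := DFunLike.congr_fun hx.2 i
        simp only [Finsupp.add_apply] at this
        omega
      rw [h2]
    · rintro ⟨p, q⟩ hx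
      rw [Finset.mem_erase, Finset.HasAntidiagonal.mem_antidiagonal] at hx ⊢
      refine ⟨?_, by simpa [add_comm] using hx.2⟩
      intro h
      apply hx.1
      simp only [Prod.swap_prod_mk, Prod.mk.injEq] at h ⊢
      exact ⟨h.2, h.1⟩
    · rintro ⟨p, q⟩ _
      rfl
  rw [this, add_zero]

theorem th_idem (i : Fin 2) (f : PS Q) : th i (th i f) = th i f := by
  ext n
  simp only [coeff_th]
  rw [← mul_assoc]
  congr 1
  rcases Nat.even_or_odd (n i) with h | h
  · have : ((n i : ℕ) : Q) = 0 := (CharP.cast_eq_zero_iff Q 2 _).2 h.two_dvd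
    rw [this, mul_zero]
  · obtain ⟨k, hk⟩ := h
    have : ((n i : ℕ) : Q) = 1 := by
      rw [hk]; push_cast; rw [CharTwo.two_eq_zero]; ring
    rw [this, mul_one]

theorem th_dl (i : Fin 2) (A : (PS Q)ˣ) : th i (dl i A) = dl i A - dl i A ^ 2 := by
  apply A.isUnit.mul_left_cancel
  have h := th_idem i (A : PS Q)
  rw [th_eq, th_mul, th_eq] at h
  linear_combination h

theorem om_key (A B : (PS Q)ˣ) :
    om A B + th 0 (om A B) + th 1 (om A B) + th 0 (th 1 (om A B)) = om A B ^ 2 := by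
  have a0 := th_dl 0 A
  have a1 := th_dl 1 A
  have b0 := th_dl 0 B
  have b1 := th_dl 1 B
  have za := dl_symm A
  have zb := dl_symm B
  have h2 : (2 : PS Q) = 0 := PS_two
  have tsq : ∀ i (f : PS Q), th i (f ^ 2) = 0 := by
    intro i f
    rw [pow_two, th_mul]
    linear_combination (f * th i f) * h2
  have zza : th 0 (th 1 (dl 0 A)) = th 1 (dl 0 A) := by
    rw [th_comm, a0, map_sub, tsq, sub_zero]
  have zzb : th 0 (th 1 (dl 0 B)) = th 1 (dl 0 B) := by
    rw [th_comm, b0, map_sub, tsq, sub_zero]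
  unfold om
  simp only [map_sub, map_add, th_mul, a0, a1, b0, b1, za, zb, zza, zzb, tsq, sub_zero]
  generalize dl 0 A = p
  generalize dl 1 A = q
  generalize dl 0 B = r
  generalize dl 1 B = t
  generalize th 1 p = z
  generalize th 1 r = e
  linear_combination (2*p*t - 2*q*r + p*e - p^2*t + q*r^2 - r*z - p*t^2 + t*z - q*e + q^2*r
    - q^2*r^2 + p*t*q*r) * h2

theorem nn_double (N : ℕ) : nn (2 * N) = nn N + nn N := by
  ext i
  simp [two_mul]

theorem coeff_om_pow (m : ℕ) (A B : (PS Q)ˣ) :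
    MvPowerSeries.coeff (nn (2 ^ m)) (om A B) = (MvPowerSeries.coeff (nn 1) (om A B)) ^ (2 ^ m) := by
  induction m with
  | zero => simp
  | succ m ih =>
    have h := congrArg (MvPowerSeries.coeff (nn (2 ^ (m + 1)))) (om_key A B)
    have h0 : ((2 ^ (m + 1) : ℕ) : Q) = 0 := (CharP.cast_eq_zero_iff Q 2 _).2 (by
      rw [pow_succ]; exact dvd_mul_left _ _)
    simp only [map_add, coeff_th, nn_apply, h0, zero_mul, add_zero] at h
    rw [h, pow_succ 2 m, mul_comm, nn_double, coeff_sq, ih, ← pow_mul, mul_comm]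

theorem nn_one : nn 1 = Finsupp.single 0 1 + Finsupp.single 1 1 := by
  ext i
  fin_cases i <;> simp

theorem coeff_one_om (A B : (PS Q)ˣ) (a a0 a1 b b0 b1 : Q)
    (hA : (A : PS Q) - (MvPowerSeries.C a + MvPowerSeries.C a0 * MvPowerSeries.X 0 +
      MvPowerSeries.C a1 * MvPowerSeries.X 1) ∈ J Q 2)
    (hB : (B : PS Q) - (MvPowerSeries.C b + MvPowerSeries.C b0 * MvPowerSeries.X 0 +
      MvPowerSeries.C b1 * MvPowerSeries.X 1) ∈ J Q 2) (ha : a ≠ 0) (hb : b ≠ 0) :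
    MvPowerSeries.coeff (nn 1) (om A B) = (a0 * b1 - a1 * b0) / (a * b) := by
  have hX : ∀ (i : Fin 2), (MvPowerSeries.X i : PS Q) ∈ J Q 1 := by
    intro i
    rw [mem_J_iff]
    intro n hn
    have : n = 0 := by
      rw [← Finsupp.degree_eq_zero_iff]; omega
    rw [this]; simp
  have thX : ∀ i j : Fin 2, th i (MvPowerSeries.X j : PS Q) =
      if i = j then MvPowerSeries.X j else 0 := by
    intro i j
    ext n
    rw [coeff_th, MvPowerSeries.coeff_X]
    split_ifs with h1 h2 h2
    · rw [MvPowerSeries.coeff_X, if_pos h1, h1, h2]; simp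
    · rw [h1]; simp [h2]
    · rw [MvPowerSeries.coeff_X, if_neg h1, mul_zero]
    · simp
  have thC : ∀ (i : Fin 2) (c : Q), th i (MvPowerSeries.C c : PS Q) = 0 := by
    intro i c
    ext n
    rw [coeff_th, MvPowerSeries.coeff_C]
    split_ifs with h
    · rw [h]; simp
    · simp
  have key : ∀ (A : PS Q) (a a0 a1 : Q),
      (A - (MvPowerSeries.C a + MvPowerSeries.C a0 * MvPowerSeries.X 0 +
      MvPowerSeries.C a1 * MvPowerSeries.X 1) ∈ J Q 2) →
      (A - MvPowerSeries.C a ∈ J Q 1) ∧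
      (th 0 A - MvPowerSeries.C a0 * MvPowerSeries.X 0 ∈ J Q 2) ∧
      (th 1 A - MvPowerSeries.C a1 * MvPowerSeries.X 1 ∈ J Q 2) := by
    intro A a a0 a1 h
    refine ⟨?_, ?_, ?_⟩
    · have h1 := J_anti (R := Q) (show 1 ≤ 2 by norm_num) h
      have h2 := Ideal.add_mem _ (Ideal.add_mem _ h1 (Ideal.mul_mem_left _ (MvPowerSeries.C a0)
        (hX 0))) (Ideal.mul_mem_left _ (MvPowerSeries.C a1) (hX 1))
      convert h2 using 1
      ring
    · have := th_mem_J 0 h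
      simpa [th_mul, thC, thX] using this
    · have := th_mem_J 1 h
      simpa [th_mul, thC, thX] using this
  obtain ⟨hA0, hA1, hA2⟩ := key _ _ _ _ hA
  obtain ⟨hB0, hB1, hB2⟩ := key _ _ _ _ hB
  have up : ∀ (i : Fin 2) (f : PS Q) (c : Q), f - MvPowerSeries.C c * MvPowerSeries.X i ∈ J Q 2 →
      f ∈ J Q 1 := by
    intro i f c h
    have h1 := J_anti (R := Q) (show 1 ≤ 2 by norm_num) h
    have h2 := Ideal.add_mem _ h1 (Ideal.mul_mem_left _ (MvPowerSeries.C c) (hX i))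
    convert h2 using 1
    ring
  set g : PS Q := th 0 (A : PS Q) * th 1 (B : PS Q) - th 1 (A : PS Q) * th 0 (B : PS Q) with hg
  have hgf : g = A * B * om A B := by
    rw [hg, th_eq, th_eq, th_eq, th_eq]; unfold om; ring
  have hCX : ∀ (c : Q) (i : Fin 2), MvPowerSeries.C c * MvPowerSeries.X i ∈ J Q 1 :=
    fun c i => Ideal.mul_mem_left _ _ (hX i)
  have hg2 : g ∈ J Q 2 := Ideal.sub_mem _ (mul_mem_J (k := 1) (l := 1) (up _ _ _ hA1) (up _ _ _ hB2))
      (mul_mem_J (k := 1) (l := 1) (up _ _ _ hA2) (up _ _ _ hB1))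
  have hom2 : om A B ∈ J Q 2 := by
    have : om A B = ((A * B)⁻¹ : (PS Q)ˣ) * g := by
      rw [hgf, ← Units.val_mul, Units.inv_mul_cancel_left]
    rw [this]
    exact Ideal.mul_mem_left _ _ hg2
  have hg3 : g - MvPowerSeries.C (a0 * b1 - a1 * b0) * (MvPowerSeries.X 0 * MvPowerSeries.X 1) ∈
      J Q 3 := by
    have e1 := mul_mem_J (k := 2) (l := 1) hA1 (up _ _ _ hB2)
    have e2 := mul_mem_J (k := 1) (l := 2) (hCX a0 0) hB2
    have e3 := mul_mem_J (k := 2) (l := 1) hA2 (up _ _ _ hB1)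
    have e4 := mul_mem_J (k := 1) (l := 2) (hCX a1 1) hB1
    have := Ideal.sub_mem _ (Ideal.add_mem _ e1 e2) (Ideal.add_mem _ e3 e4)
    convert this using 1
    rw [hg, map_sub, map_mul, map_mul]
    ring
  have hf3 : g - MvPowerSeries.C (a * b) * om A B ∈ J Q 3 := by
    have e1 := mul_mem_J (k := 1) (l := 2) hA0 (Ideal.mul_mem_left _ (B : PS Q) hom2)
    have e2 := mul_mem_J (k := 1) (l := 2) hB0 (Ideal.mul_mem_left _ (MvPowerSeries.C a) hom2)
    have := Ideal.add_mem _ e1 e2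
    convert this using 1
    rw [hgf, map_mul]
    ring
  have hd : (nn 1).degree < 3 := by rw [nn_degree]; norm_num
  have c1 := mem_J_iff.1 hg3 _ hd
  have c2 := mem_J_iff.1 hf3 _ hd
  have c3 : MvPowerSeries.coeff (nn 1) (MvPowerSeries.X 0 * MvPowerSeries.X 1 : PS Q) = 1 := by
    rw [MvPowerSeries.X, MvPowerSeries.X, MvPowerSeries.monomial_mul_monomial, nn_one]
    simp
  rw [map_sub, MvPowerSeries.coeff_C_mul, c3, mul_one, sub_eq_zero] at c1
  rw [map_sub, MvPowerSeries.coeff_C_mul, c1, sub_eq_zero] at c2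
  rw [eq_div_iff (mul_ne_zero ha hb), c2]
  ring

end charTwo
end Milnor


namespace Milnor
set_option linter.unusedSectionVars false
section core
variable {F Q W : Type*} [Field F] [Field Q] [CharP F 2] [CharP Q 2] [CommRing W] [IsDomain W]

/-- The series with given coefficients. -/
def mkPS {R : Type*} [CommRing R] (c : (Fin 2 →₀ ℕ) → R) : PS R := c

theorem coeff_mkPS {R : Type*} [CommRing R] (c : (Fin 2 →₀ ℕ) → R) (n : Fin 2 →₀ ℕ) :
    MvPowerSeries.coeff n (mkPS c) = c n := rfl

theorem ker_split (ρ : W →+* Q) (hker : ∀ w, ρ w = 0 → (2 : W) ∣ w) (k : ℕ) (X : PS W)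
    (h : MvPowerSeries.map ρ X ∈ J Q k) : ∃ c : PS W, X - 2 * c ∈ J W k := by
  rw [mem_J_iff] at h
  have : ∀ n : Fin 2 →₀ ℕ, ∃ c : W, n.degree < k → MvPowerSeries.coeff n X = 2 * c := by
    intro n
    by_cases hn : n.degree < k
    · have := h n hn
      rw [MvPowerSeries.coeff_map] at this
      obtain ⟨c, hc⟩ := hker _ this
      exact ⟨c, fun _ => hc⟩
    · exact ⟨0, fun h => absurd h hn⟩
  choose c hc using this
  refine ⟨mkPS c, ?_⟩
  rw [mem_J_iff]
  intro n hn
  rw [map_sub, hc n hn]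
  have : (2 : PS W) = MvPowerSeries.C (2 : W) := (map_ofNat _ 2).symm
  have h2 : MvPowerSeries.coeff n ((2 : PS W) * mkPS c) = 2 * c n := by
    rw [this, MvPowerSeries.coeff_C_mul]; rfl
  rw [h2, sub_self]

theorem unit_of_one (ρ : W →+* Q) (hunit : ∀ w, ρ w ≠ 0 → IsUnit w) (k : ℕ) (X : PS W)
    (h : MvPowerSeries.map ρ X - 1 ∈ J Q (k + 1)) : IsUnit X := by
  rw [MvPowerSeries.isUnit_iff_constantCoeff]
  apply hunit
  have := mem_J_iff.1 h 0 (by simp)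
  rw [map_sub, MvPowerSeries.coeff_map, MvPowerSeries.coeff_zero_eq_constantCoeff,
    MvPowerSeries.coeff_zero_eq_constantCoeff, map_one, sub_eq_zero] at this
  rw [this]
  exact one_ne_zero

theorem om_one (ρ : W →+* Q) (hker : ∀ w, ρ w = 0 → (2 : W) ∣ w)
    (hρ2 : ρ 2 = 0)
    (hunit : ∀ w, ρ w ≠ 0 → IsUnit w) (m : ℕ) (A B : (PS W)ˣ)
    (h : MvPowerSeries.map ρ (A : PS W) - 1 ∈ J Q (2 * 2 ^ m + 1)) :
    (2 : W) ^ (m + 1) ∣ MvPowerSeries.coeff (nn (2 ^ m)) (om A B) := by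
  obtain ⟨c, hc⟩ := ker_split ρ hker _ ((A : PS W) - 1) (by rw [map_sub, map_one]; exact h)
  have hmap2 : MvPowerSeries.map ρ (1 + 2 * c) = 1 := by
    have : (2 : PS W) = MvPowerSeries.C (2 : W) := (map_ofNat _ 2).symm
    rw [this, map_add, map_mul, MvPowerSeries.map_C, hρ2, map_zero, zero_mul, add_zero, map_one]
  obtain ⟨U, hU⟩ := unit_of_one ρ hunit 0 (1 + 2 * c) (by rw [hmap2, sub_self]; exact zero_mem _)
  have hA : A = U * (U⁻¹ * A) := by rw [mul_inv_cancel_left]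
  rw [hA, om_mul_left, map_add]
  refine dvd_add (om_one_add_two m U B c hU) ?_
  rw [om_one_add_J (2 ^ m) (U⁻¹ * A) B]
  · exact dvd_zero _
  · have e : ((U⁻¹ * A : (PS W)ˣ) : PS W) - 1 = (U⁻¹ : (PS W)ˣ) * ((A : PS W) - 1 - 2 * c) := by
      have : (A : PS W) - 1 - 2 * c = A - U := by rw [hU]; ring
      rw [this, mul_sub, Units.inv_mul, Units.val_mul]
    rw [e]
    exact Ideal.mul_mem_left _ _ hc

theorem om_congr (ρ : W →+* Q) (hker : ∀ w, ρ w = 0 → (2 : W) ∣ w)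
    (hρ2 : ρ 2 = 0)
    (hunit : ∀ w, ρ w ≠ 0 → IsUnit w) (m : ℕ) (A A' B : (PS W)ˣ)
    (h : MvPowerSeries.map ρ (A : PS W) - MvPowerSeries.map ρ (A' : PS W) ∈ J Q (2 * 2 ^ m + 1)) :
    (2 : W) ^ (m + 1) ∣ MvPowerSeries.coeff (nn (2 ^ m)) (om A B) -
      MvPowerSeries.coeff (nn (2 ^ m)) (om A' B) := by
  have h1 : om A B - om A' B = om (A * A'⁻¹) B := by
    rw [om_mul_left, om_inv_left]; ring
  rw [← map_sub, h1]
  apply om_one ρ hker hρ2 hunit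
  have : MvPowerSeries.map ρ ((A * A'⁻¹ : (PS W)ˣ) : PS W) - 1 =
      MvPowerSeries.map ρ ((A'⁻¹ : (PS W)ˣ) : PS W) *
        (MvPowerSeries.map ρ (A : PS W) - MvPowerSeries.map ρ (A' : PS W)) := by
    rw [← map_sub, ← map_mul, mul_sub, Units.inv_mul, map_sub, map_one, Units.val_mul, mul_comm]
  rw [this]
  exact Ideal.mul_mem_left _ _ h

theorem exists_Lam (ρ : W →+* Q)
    (hsurj : Function.Surjective ρ) (hker : ∀ w, ρ w = 0 → (2 : W) ∣ w)
    (hunit : ∀ w, ρ w ≠ 0 → IsUnit w) (m : ℕ)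
    (h : F →+* PS Q ⧸ J Q (2 * 2 ^ m + 1)) :
    ∃ (Λ : K F 2 →+ W ⧸ (Ideal.span {(2 : W) ^ (m + 1)} : Ideal W)) (L : Fˣ → (PS W)ˣ),
      (∀ a, Ideal.Quotient.mk (J Q (2 * 2 ^ m + 1)) (MvPowerSeries.map ρ (L a : PS W)) = h a) ∧
      ∀ a b, Λ (sy a b) = Ideal.Quotient.mk (Ideal.span {(2 : W) ^ (m + 1)} : Ideal W)
        (MvPowerSeries.coeff (nn (2 ^ m)) (om (L a) (L b))) := by
  have hρ2 : ρ 2 = 0 := by rw [map_ofNat]; exact CharTwo.two_eq_zero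
  let q : PS W →+* PS Q ⧸ J Q (2 * 2 ^ m + 1) := (Ideal.Quotient.mk _).comp (MvPowerSeries.map ρ)
  have hq : ∀ X, q X = Ideal.Quotient.mk _ (MvPowerSeries.map ρ X) := fun _ => rfl
  have hqs : Function.Surjective q := by
    intro t
    obtain ⟨A, rfl⟩ := Ideal.Quotient.mk_surjective t
    choose g hg using hsurj
    refine ⟨mkPS (fun n => g (MvPowerSeries.coeff n A)), ?_⟩
    rw [hq]
    congr 1
    ext n
    rw [MvPowerSeries.coeff_map, coeff_mkPS, hg]
  have hqeq : ∀ X Y, q X = q Y → MvPowerSeries.map ρ X - MvPowerSeries.map ρ Y ∈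
      J Q (2 * 2 ^ m + 1) := fun X Y h => Ideal.Quotient.eq.1 h
  have hunit1 : ∀ X, q X = 1 → IsUnit X := by
    intro X hX
    refine unit_of_one ρ hunit (2 * 2 ^ m) X ?_
    have := hqeq X 1 (by rw [hX, map_one])
    rwa [map_one] at this
  have hlu : ∀ (a : Fˣ) (X : PS W), q X = h a → IsUnit X := by
    intro a X hX
    obtain ⟨Y, hY⟩ := hqs (h ((a⁻¹ : Fˣ) : F))
    have : IsUnit (X * Y) := hunit1 _ (by
      rw [map_mul, hX, hY, ← map_mul, Units.mul_inv, map_one])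
    exact isUnit_of_mul_isUnit_left this
  have hex : ∀ a : Fˣ, ∃ A : (PS W)ˣ, q A = h a := by
    intro a
    obtain ⟨X, hX⟩ := hqs (h a)
    obtain ⟨A, hA⟩ := hlu a X hX
    exact ⟨A, by rw [hA, hX]⟩
  choose L hL using hex
  let I : Ideal W := Ideal.span {(2 : W) ^ (m + 1)}
  let ψ : (PS W)ˣ → (PS W)ˣ → W ⧸ I := fun A B =>
    Ideal.Quotient.mk I (MvPowerSeries.coeff (nn (2 ^ m)) (om A B))
  have hψl : ∀ A A' B : (PS W)ˣ, q A = q A' → ψ A B = ψ A' B := by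
    intro A A' B h
    refine Ideal.Quotient.eq.2 (Ideal.mem_span_singleton.2 ?_)
    exact om_congr ρ hker hρ2 hunit m A A' B (hqeq _ _ h)
  have hψs : ∀ A B, ψ A B = - ψ B A := by
    intro A B
    change Ideal.Quotient.mk I _ = - Ideal.Quotient.mk I _
    rw [om_swap, map_neg, map_neg]
  have hψr : ∀ A B B' : (PS W)ˣ, q B = q B' → ψ A B = ψ A B' := by
    intro A B B' h
    rw [hψs A B, hψs A B', hψl _ _ _ h]
  have hψml : ∀ A A' B, ψ (A * A') B = ψ A B + ψ A' B := by
    intro A A' B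
    change Ideal.Quotient.mk I _ = Ideal.Quotient.mk I _ + Ideal.Quotient.mk I _
    rw [om_mul_left, map_add, map_add]
  have hψmr : ∀ A B B', ψ A (B * B') = ψ A B + ψ A B' := by
    intro A B B'
    change Ideal.Quotient.mk I _ = Ideal.Quotient.mk I _ + Ideal.Quotient.mk I _
    rw [om_mul_right, map_add, map_add]
  refine ⟨K2lift (fun a b => ψ (L a) (L b))
    (by
      intro a a' b
      rw [← hψml]
      apply hψl
      rw [Units.val_mul, map_mul, hL, hL, hL, Units.val_mul, map_mul])
    (by
      intro a b b'
      rw [← hψmr]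
      apply hψr
      rw [Units.val_mul, map_mul, hL, hL, hL, Units.val_mul, map_mul])
    (by
      intro a b hab
      have hb : (b : F) = 1 - a := by rw [← hab]; ring
      have hq1 : q (1 - (L a : PS W)) = h b := by
        rw [map_sub, map_one, hL, hb, map_sub, map_one]
      obtain ⟨B, hB⟩ := hlu b _ hq1
      rw [hψr (L a) (L b) B (by rw [hL, hB, hq1])]
      change Ideal.Quotient.mk I _ = 0
      rw [om_steinberg, map_zero, map_zero]
      rw [hB]; ring), L, hL, fun a b => K2lift_sy _ _ _ _ _ _⟩

theorem core (D1 D2 : Derivation ℤ F F) (ι : F →+* Q) (ρ : W →+* Q)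
    (hsurj : Function.Surjective ρ) (hker : ∀ w, ρ w = 0 → (2 : W) ∣ w)
    (hunit : ∀ w, ρ w ≠ 0 → IsUnit w) (h20 : (2 : W) ≠ 0) (m : ℕ)
    (h : F →+* PS Q ⧸ J Q (2 * 2 ^ m + 1))
    (hh : ∀ (a : F) (A : PS Q), Ideal.Quotient.mk _ A = h a →
      A - (MvPowerSeries.C (ι a) + MvPowerSeries.C (ι (D1 a)) * MvPowerSeries.X 0 +
        MvPowerSeries.C (ι (D2 a)) * MvPowerSeries.X 1) ∈ J Q 2)
    (x y : K F 2) (hxy : 2 ^ m • x = 2 ^ (m + 1) • y) : fK D1 D2 x = 0 := by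
  have hρ2 : ρ 2 = 0 := by rw [map_ofNat]; exact CharTwo.two_eq_zero
  obtain ⟨Λ, L, hL, hΛL⟩ := exists_Lam ρ hsurj hker hunit m h
  let I : Ideal W := Ideal.span {(2 : W) ^ (m + 1)}
  let ρ' : W ⧸ I →+* Q := Ideal.Quotient.lift I ρ (by
    intro w hw
    obtain ⟨c, rfl⟩ := Ideal.mem_span_singleton.1 hw
    rw [map_mul, map_pow, hρ2, zero_pow (by omega), zero_mul])
  have hform : ∀ z : K F 2, ρ' (Λ z) = (ι (fK D1 D2 z)) ^ (2 ^ m) := by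
    intro z
    have hadd : ∀ u v : Q, (u + v) ^ (2 ^ m) = u ^ (2 ^ m) + v ^ (2 ^ m) :=
      fun u v => add_pow_char_pow u v 2 m
    induction z using K_induction with
    | h0 => simp
    | hs a b =>
      have e2 : ρ' (Λ (sy a b)) = ρ (MvPowerSeries.coeff (nn (2 ^ m)) (om (L a) (L b))) := by
        rw [hΛL]; rfl
      rw [e2, ← MvPowerSeries.coeff_map, om_map, coeff_om_pow]
      congr 1
      rw [coeff_one_om _ _ (ι a) (ι (D1 a)) (ι (D2 a)) (ι b) (ι (D1 b)) (ι (D2 b)) (hh _ _ (hL a))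
        (hh _ _ (hL b)) ((map_ne_zero ι).2 a.ne_zero) ((map_ne_zero ι).2 b.ne_zero), fK_sy,
        map_div₀, map_sub, map_mul, map_mul, map_mul]
    | hneg z ih => 
      rw [map_neg, map_neg, ih, map_neg, map_neg, CharTwo.neg_eq, CharTwo.neg_eq]
    | hadd z z' ih ih' => rw [map_add, map_add, ih, ih', map_add, map_add, hadd]
  have hΛ : ρ' (Λ x) = 0 := by
    obtain ⟨w, hw⟩ := Ideal.Quotient.mk_surjective (I := I) (Λ x)
    obtain ⟨w', hw'⟩ := Ideal.Quotient.mk_surjective (I := I) (Λ y)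
    have e := congrArg Λ hxy
    rw [map_nsmul, map_nsmul, ← hw, ← hw', ← map_nsmul, ← map_nsmul, nsmul_eq_mul, nsmul_eq_mul,
      Ideal.Quotient.eq, Ideal.mem_span_singleton] at e
    push_cast at e
    have e2 : (2 : W) ^ (m + 1) ∣ 2 ^ m * w := by
      have := dvd_add e (dvd_mul_right ((2 : W) ^ (m + 1)) w')
      simpa using this
    obtain ⟨c, hc⟩ := e2
    have e3 : w = 2 * c := by
      apply mul_left_cancel₀ (pow_ne_zero m h20)
      rw [hc]; ring
    rw [← hw]
    change ρ w = 0
    rw [e3, map_mul, hρ2, zero_mul]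
  rw [hform] at hΛ
  have := pow_eq_zero_iff (Nat.two_pow_pos m).ne' |>.1 hΛ
  exact (map_eq_zero ι).1 this

end core
end Milnor


namespace Milnor
set_option linter.unusedSectionVars false
section smooth

theorem exists_h {F Q : Type*} [Field F] [Field Q] [Algebra (ZMod 2) F] [Algebra (ZMod 2) Q]
    [Algebra.EssFiniteType (ZMod 2) F] (D1 D2 : Derivation ℤ F F) (ι : F →+* Q) (k : ℕ)
    (hk : 2 ≤ k) :
    ∃ h : F →+* PS Q ⧸ J Q k, ∀ (a : F) (A : PS Q), Ideal.Quotient.mk _ A = h a →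
      A - (MvPowerSeries.C (ι a) + MvPowerSeries.C (ι (D1 a)) * MvPowerSeries.X 0 +
        MvPowerSeries.C (ι (D2 a)) * MvPowerSeries.X 1) ∈ J Q 2 := by
  have : Algebra.FormallySmooth (ZMod 2) F := inferInstance
  have hX : ∀ (i : Fin 2), (MvPowerSeries.X i : PS Q) ∈ J Q 1 := by
    intro i
    rw [mem_J_iff]
    intro n hn
    have : n = 0 := by
      rw [← Finsupp.degree_eq_zero_iff]; omega
    rw [this]; simp
  have hXX : ∀ i j : Fin 2, (MvPowerSeries.X i * MvPowerSeries.X j : PS Q) ∈ J Q 2 :=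
    fun i j => mul_mem_J (k := 1) (l := 1) (hX i) (hX j)
  let f0 : F →+* PS Q ⧸ J Q 2 :=
    { toFun := fun a => Ideal.Quotient.mk _ (MvPowerSeries.C (ι a) +
        MvPowerSeries.C (ι (D1 a)) * MvPowerSeries.X 0 +
        MvPowerSeries.C (ι (D2 a)) * MvPowerSeries.X 1)
      map_zero' := by simp
      map_one' := by simp
      map_add' := by
        intro a b
        rw [← map_add]
        congr 1
        simp only [map_add]
        ring
      map_mul' := by
        intro a b
        rw [← map_mul, eq_comm, Ideal.Quotient.eq]
        simp only [map_add, map_mul, Derivation.leibniz, smul_eq_mul]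
        have e0 := Ideal.mul_mem_left _ (MvPowerSeries.C (ι (D1 a)) * MvPowerSeries.C (ι (D1 b)))
          (hXX 0 0)
        have e1 := Ideal.mul_mem_left _ (MvPowerSeries.C (ι (D1 a)) * MvPowerSeries.C (ι (D2 b)) +
          MvPowerSeries.C (ι (D2 a)) * MvPowerSeries.C (ι (D1 b))) (hXX 0 1)
        have e2 := Ideal.mul_mem_left _ (MvPowerSeries.C (ι (D2 a)) * MvPowerSeries.C (ι (D2 b)))
          (hXX 1 1)
        convert Ideal.add_mem _ (Ideal.add_mem _ e0 e1) e2 using 1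
        ring }
  let f : F →ₐ[ZMod 2] PS Q ⧸ J Q 2 :=
    { f0 with
      commutes' := fun r => RingHom.congr_fun
        (RingHom.ext_zmod (f0.comp (algebraMap (ZMod 2) F)) (algebraMap (ZMod 2) _)) r }
  let g0 : PS Q ⧸ J Q k →+* PS Q ⧸ J Q 2 := Ideal.Quotient.factor (J_anti hk)
  let g : PS Q ⧸ J Q k →ₐ[ZMod 2] PS Q ⧸ J Q 2 :=
    { g0 with
      commutes' := fun r => RingHom.congr_fun
        (RingHom.ext_zmod (g0.comp (algebraMap (ZMod 2) _)) (algebraMap (ZMod 2) _)) r }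
  have hgmk : ∀ A, g (Ideal.Quotient.mk _ A) = Ideal.Quotient.mk _ A := fun A => rfl
  have hg : Function.Surjective g := by
    intro t
    obtain ⟨A, rfl⟩ := Ideal.Quotient.mk_surjective t
    exact ⟨Ideal.Quotient.mk _ A, rfl⟩
  have hnil : IsNilpotent (RingHom.ker (g : PS Q ⧸ J Q k →+* PS Q ⧸ J Q 2)) := by
    have hle : RingHom.ker (g : PS Q ⧸ J Q k →+* PS Q ⧸ J Q 2) ≤
        (J Q 2).map (Ideal.Quotient.mk (J Q k)) := by
      intro t ht
      obtain ⟨A, rfl⟩ := Ideal.Quotient.mk_surjective t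
      refine Ideal.mem_map_of_mem _ ?_
      exact Ideal.Quotient.eq_zero_iff_mem.1 ht
    have hpow : ∀ r : ℕ, (J Q 2) ^ r ≤ J Q r := by
      intro r
      induction r with
      | zero => intro f _; rw [mem_J_iff]; intro n hn; omega
      | succ r ih =>
        rw [pow_succ]
        refine Ideal.mul_le.2 ?_
        intro a ha b hb
        exact J_anti (by omega) (mul_mem_J (ih ha) hb)
    refine ⟨k, ?_⟩
    rw [Ideal.zero_eq_bot, eq_bot_iff]
    refine (Ideal.pow_right_mono hle k).trans ?_
    rw [← Ideal.map_pow]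
    refine (Ideal.map_mono (hpow k)).trans ?_
    rw [Ideal.map_quotient_self]
  refine ⟨(Algebra.FormallySmooth.liftOfSurjective f g hg hnil : F →ₐ[ZMod 2] _), ?_⟩
  intro a A hA
  have h1 := Algebra.FormallySmooth.liftOfSurjective_apply f g hg hnil a
  have h2 : g (Ideal.Quotient.mk _ A) = f a := by rw [hA]; exact h1
  rw [hgmk] at h2
  exact Ideal.Quotient.eq.1 h2

theorem forms_ess {F : Type*} [Field F] [CharP F 2] [Algebra (ZMod 2) F]
    [Algebra.EssFiniteType (ZMod 2) F] (m : ℕ) (x y : K F 2)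
    (hxy : 2 ^ m • x = 2 ^ (m + 1) • y) : ∃ z, x = 2 • z := by
  apply forms_detect
  intro D1 D2
  let Q := PerfectClosure F 2
  let ι : F →+* Q := PerfectClosure.of F 2
  letI : Algebra (ZMod 2) Q := (ι.comp (algebraMap (ZMod 2) F)).toAlgebra
  have hN : 1 ≤ 2 ^ m := Nat.one_le_two_pow
  obtain ⟨h, hh⟩ := exists_h (Q := Q) D1 D2 ι (2 * 2 ^ m + 1) (by omega)
  refine core (W := WittVector 2 Q) D1 D2 ι (WittVector.constantCoeff)
    (WittVector.constantCoeff_surjective 2) ?_ ?_ ?_ m h hh x y hxy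
  · intro w hw
    have : w ∈ RingHom.ker (WittVector.constantCoeff (p := 2) (R := Q)) := hw
    rw [WittVector.ker_constantCoeff, Ideal.mem_span_singleton] at this
    simpa using this
  · intro w hw
    exact WittVector.isUnit_of_coeff_zero_ne_zero w hw
  · have := WittVector.p_nonzero 2 Q
    simpa using this

end smooth
end Milnor

namespace Milnor
section limit
variable {F : Type*} [Field F] [Algebra (ZMod 2) F]

/-- Map on tuples of units. -/
def um (E : IntermediateField (ZMod 2) F) (v : Fin 2 → Eˣ) : Fin 2 → Fˣ :=
  fun i => Units.map (algebraMap E F : E →* F) (v i)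

theorem um_val (E : IntermediateField (ZMod 2) F) (v : Fin 2 → Eˣ) (i : Fin 2) :
    ((um E v i : Fˣ) : F) = ((v i : E) : F) := rfl

theorem um_injective (E : IntermediateField (ZMod 2) F) : Function.Injective (um E) := by
  intro u v h
  funext i
  apply Units.ext
  apply Subtype.ext
  rw [← um_val, ← um_val, h]

theorem um_surj (E : IntermediateField (ZMod 2) F) (u : Fin 2 → Fˣ) (h : ∀ i, (u i : F) ∈ E) :
    ∃ v, um E v = u := by
  refine ⟨fun i => Units.mk0 ⟨(u i : F), h i⟩ (fun h0 => (u i).ne_zero (congrArg Subtype.val h0)),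
    ?_⟩
  funext i
  apply Units.ext
  rfl

/-- Map on free groups. -/
noncomputable def fm (E : IntermediateField (ZMod 2) F) :
    FreeAbelianGroup (Fin 2 → Eˣ) →+ FreeAbelianGroup (Fin 2 → Fˣ) := FreeAbelianGroup.map (um E)

theorem fm_of (E : IntermediateField (ZMod 2) F) (v : Fin 2 → Eˣ) :
    fm E (FreeAbelianGroup.of v) = FreeAbelianGroup.of (um E v) := FreeAbelianGroup.map_of_apply _

theorem fm_injective (E : IntermediateField (ZMod 2) F) : Function.Injective (fm E) := by
  have h : Function.LeftInverse (FreeAbelianGroup.map (Function.invFun (um E))) (fm E) := by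
    intro x
    unfold fm
    rw [← FreeAbelianGroup.map_comp_apply]
    rw [Function.invFun_comp (um_injective E), FreeAbelianGroup.map_id_apply]
  exact h.injective

theorem fm_rels (E : IntermediateField (ZMod 2) F) : rels E 2 ≤ (rels F 2).comap (fm E) := by
  rw [rels, AddSubgroup.closure_le]
  rintro x (⟨i, u, v, w, h, hw, rfl⟩ | ⟨i, j, u, hij, h, rfl⟩)
  · simp only [SetLike.mem_coe, AddSubgroup.mem_comap, map_sub, fm_of]
    apply AddSubgroup.subset_closure
    left
    refine ⟨i, um E u, um E v, um E w, ?_, ?_, rfl⟩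
    · intro j hj
      obtain ⟨h1, h2⟩ := h j hj
      simp only [um]
      rw [← h1, ← h2]
      exact ⟨rfl, rfl⟩
    · simp only [um]
      rw [hw, map_mul]
  · simp only [SetLike.mem_coe, AddSubgroup.mem_comap, fm_of]
    apply AddSubgroup.subset_closure
    right
    refine ⟨i, j, um E u, hij, ?_, rfl⟩
    rw [um_val, um_val]
    exact congrArg Subtype.val h

/-- Map on `K₂`. -/
noncomputable def km (E : IntermediateField (ZMod 2) F) : K E 2 →+ K F 2 :=
  QuotientAddGroup.map (rels E 2) (rels F 2) (fm E) (fm_rels E)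

theorem tuple_fin (u : Fin 2 → Fˣ) : ∃ S : Finset F, ∀ E : IntermediateField (ZMod 2) F,
    (∀ x ∈ S, x ∈ E) → ∃ v, um E v = u := by
  classical
  refine ⟨Finset.univ.image (fun i => (u i : F)), fun E hE => um_surj E u fun i => hE _ ?_⟩
  simp

theorem fm_fin (X : FreeAbelianGroup (Fin 2 → Fˣ)) : ∃ S : Finset F,
    ∀ E : IntermediateField (ZMod 2) F, (∀ x ∈ S, x ∈ E) → ∃ X0, fm E X0 = X := by
  classical
  induction X using FreeAbelianGroup.induction_on with
  | zero => exact ⟨∅, fun E _ => ⟨0, map_zero _⟩⟩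
  | of v =>
    obtain ⟨S, hS⟩ := tuple_fin v
    refine ⟨S, fun E hE => ?_⟩
    obtain ⟨u, rfl⟩ := hS E hE
    exact ⟨_, fm_of E u⟩
  | neg v ih =>
    obtain ⟨S, hS⟩ := ih
    refine ⟨S, fun E hE => ?_⟩
    obtain ⟨u, hu⟩ := hS E hE
    exact ⟨-u, by rw [map_neg, hu]⟩
  | add x y hx hy =>
    obtain ⟨S, hS⟩ := hx
    obtain ⟨T, hT⟩ := hy
    refine ⟨S ∪ T, fun E hE => ?_⟩
    obtain ⟨u, hu⟩ := hS E fun x hx => hE x (by simp [hx])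
    obtain ⟨v, hv⟩ := hT E fun x hx => hE x (by simp [hx])
    exact ⟨u + v, by rw [map_add, hu, hv]⟩

theorem rels_fin (z : FreeAbelianGroup (Fin 2 → Fˣ)) (hz : z ∈ rels F 2) : ∃ S : Finset F,
    ∀ E : IntermediateField (ZMod 2) F, (∀ x ∈ S, x ∈ E) → ∃ z0 ∈ rels E 2, fm E z0 = z := by
  classical
  unfold rels at hz
  induction hz using AddSubgroup.closure_induction with
  | mem x hx =>
    obtain ⟨i, u, v, w, h, hw, rfl⟩ | ⟨i, j, u, hij, h, rfl⟩ := hx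
    · obtain ⟨S, hS⟩ := tuple_fin u
      obtain ⟨T, hT⟩ := tuple_fin v
      obtain ⟨W, hW⟩ := tuple_fin w
      refine ⟨S ∪ T ∪ W, fun E hE => ?_⟩
      obtain ⟨u0, rfl⟩ := hS E fun x hx => hE x (by simp [hx])
      obtain ⟨v0, rfl⟩ := hT E fun x hx => hE x (by simp [hx])
      obtain ⟨w0, rfl⟩ := hW E fun x hx => hE x (by simp [hx])
      have inj : ∀ (p q : Fin 2 → Eˣ) (j : Fin 2), um E p j = um E q j → p j = q j := by
        intro p q j hj
        apply Units.ext
        apply Subtype.ext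
        rw [← um_val, ← um_val, hj]
      refine ⟨FreeAbelianGroup.of w0 - FreeAbelianGroup.of u0 - FreeAbelianGroup.of v0,
        AddSubgroup.subset_closure (Or.inl ⟨i, u0, v0, w0, ?_, ?_, rfl⟩), ?_⟩
      · intro j hj
        exact ⟨inj _ _ _ (h j hj).1, inj _ _ _ (h j hj).2⟩
      · apply Units.ext
        apply Subtype.ext
        have := congrArg Units.val hw
        exact this
      · rw [map_sub, map_sub, fm_of, fm_of, fm_of]
    · obtain ⟨S, hS⟩ := tuple_fin u
      refine ⟨S, fun E hE => ?_⟩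
      obtain ⟨u0, rfl⟩ := hS E hE
      refine ⟨FreeAbelianGroup.of u0,
        AddSubgroup.subset_closure (Or.inr ⟨i, j, u0, hij, ?_, rfl⟩), fm_of E u0⟩
      apply Subtype.ext
      exact h
  | zero => exact ⟨∅, fun E _ => ⟨0, zero_mem _, map_zero _⟩⟩
  | add x y _ _ hx hy =>
    obtain ⟨S, hS⟩ := hx
    obtain ⟨T, hT⟩ := hy
    refine ⟨S ∪ T, fun E hE => ?_⟩
    obtain ⟨u, hu', hu⟩ := hS E fun x hx => hE x (by simp [hx])
    obtain ⟨v, hv', hv⟩ := hT E fun x hx => hE x (by simp [hx])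
    exact ⟨u + v, add_mem hu' hv', by rw [map_add, hu, hv]⟩
  | neg x _ hx =>
    obtain ⟨S, hS⟩ := hx
    refine ⟨S, fun E hE => ?_⟩
    obtain ⟨u, hu', hu⟩ := hS E hE
    exact ⟨-u, neg_mem hu', by rw [map_neg, hu]⟩

end limit

section final
variable {F : Type*} [Field F] [CharP F 2]

theorem forms_gen (m : ℕ) (x y : K F 2) (hxy : 2 ^ m • x = 2 ^ (m + 1) • y) :
    ∃ z, x = 2 • z := by
  classical
  letI : Algebra (ZMod 2) F := ZMod.algebra F 2
  obtain ⟨X, rfl⟩ := QuotientAddGroup.mk_surjective (s := rels F 2) x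
  obtain ⟨Y, rfl⟩ := QuotientAddGroup.mk_surjective (s := rels F 2) y
  have hz : 2 ^ m • X - 2 ^ (m + 1) • Y ∈ rels F 2 := by
    refine (QuotientAddGroup.eq_zero_iff (N := rels F 2) _).1 ?_
    exact sub_eq_zero.2 hxy
  obtain ⟨S, hS⟩ := fm_fin X
  obtain ⟨T, hT⟩ := fm_fin Y
  obtain ⟨W, hW⟩ := rels_fin _ hz
  let E : IntermediateField (ZMod 2) F :=
    IntermediateField.adjoin (ZMod 2) ((S ∪ T ∪ W : Finset F) : Set F)
  have hsub : ∀ x ∈ S ∪ T ∪ W, x ∈ E := fun x hx =>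
    IntermediateField.subset_adjoin (ZMod 2) _ (Finset.mem_coe.2 hx)
  obtain ⟨X0, hX⟩ := hS E fun x hx => hsub x (by simp [hx])
  obtain ⟨Y0, hY⟩ := hT E fun x hx => hsub x (by simp [hx])
  obtain ⟨z0, hz0, hz1⟩ := hW E fun x hx => hsub x (by simp [hx])
  have e : 2 ^ m • X0 - 2 ^ (m + 1) • Y0 = z0 := by
    apply fm_injective E
    rw [hz1, map_sub, map_nsmul, map_nsmul, hX, hY]
  rw [← e] at hz0
  have h0 := (QuotientAddGroup.eq_zero_iff (N := rels E 2) _).2 hz0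
  haveI : CharP E 2 := charP_of_injective_algebraMap (algebraMap (ZMod 2) E).injective 2
  haveI : Algebra.EssFiniteType (ZMod 2) E :=
    IntermediateField.essFiniteType_iff.2 ⟨S ∪ T ∪ W, rfl⟩
  obtain ⟨z, hz⟩ := forms_ess (F := E) m (QuotientAddGroup.mk X0 : K E 2)
    (QuotientAddGroup.mk Y0 : K E 2) (sub_eq_zero.1 h0)
  refine ⟨km E z, ?_⟩
  have h2 := congrArg (km E) hz
  rw [map_nsmul] at h2
  rw [← h2, ← hX]
  rfl

theorem div_iter (n : ℕ) : ∀ (j : ℕ) (x y : K F 2), 2 ^ j • x = 2 ^ (n + j) • y →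
    ∃ z, x = 2 ^ n • z := by
  induction n with
  | zero => intro j x y _; exact ⟨x, by simp⟩
  | succ n ih =>
    intro j x y h
    obtain ⟨z, rfl⟩ := forms_gen j x (2 ^ n • y) (by
      rw [h, smul_smul]; congr 1; ring)
    obtain ⟨t, rfl⟩ := ih (j + 1) z y (by
      rw [pow_succ, mul_smul, h]; congr 2; ring)
    exact ⟨t, by rw [smul_smul]; congr 1; ring⟩

theorem sy_two (a b : Fˣ) (z : K F 2) (h : sy a b = 2 • z) :
    ∃ u1 v1 u2 v2 : Fˣ, sy a b = 2 • (sy u1 v1 + sy u2 v2) := by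
  have hk : ∀ x : F, x ^ 2 ∈ (frobenius F 2).fieldRange := fun x => ⟨x, rfl⟩
  by_cases ha : (a : F) ∈ (frobenius F 2).fieldRange
  · obtain ⟨c, hc⟩ := ha
    have hc' : c ^ 2 = (a : F) := hc
    have hc0 : c ≠ 0 := by rintro rfl; exact a.ne_zero (by rw [← hc']; simp)
    refine ⟨Units.mk0 c hc0, b, 1, 1, ?_⟩
    have : a = Units.mk0 c hc0 * Units.mk0 c hc0 := by
      ext; simp [← hc', pow_two]
    rw [sy_one_left, add_zero, two_smul, ← sy_mul_left, ← this]
  by_cases hb : (b : F) ∈ ext _ hk (a : F)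
  swap
  · exfalso
    obtain ⟨D1, h1, h1'⟩ := exists_der _ hk _ ha
    obtain ⟨D2, h2, h2'⟩ := exists_der _ (fun x => le_ext _ hk _ (hk x)) _ hb
    have := fK_two D1 D2 z
    rw [← h, fK_sy, h2 _ (self_mem_ext _ hk _), zero_mul, sub_zero, div_eq_zero_iff] at this
    simp [h1', h2'] at this
  obtain ⟨_, ⟨x, rfl⟩, _, ⟨y, rfl⟩, hxy⟩ := mem_ext.1 hb
  simp only [frobenius_def] at hxy
  by_cases hx : x = 0
  · have hy : y ≠ 0 := by
      rintro rfl; apply b.ne_zero; rw [hxy, hx]; simp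
    refine ⟨a, Units.mk0 y hy, 1, 1, ?_⟩
    have : b = Units.mk0 y hy * Units.mk0 y hy * a := by
      ext; simp [hxy, hx, pow_two]
    rw [this, sy_mul_right, sy_mul_right, sy_self, sy_one_left, two_smul]; abel
  by_cases hy : y = 0
  · refine ⟨a, Units.mk0 x hx, 1, 1, ?_⟩
    have : b = Units.mk0 x hx * Units.mk0 x hx := by
      ext; simp [hxy, hy, pow_two]
    rw [this, sy_mul_right, sy_one_left, two_smul]; abel
  · set X := Units.mk0 x hx
    set Z := Units.mk0 (y / x) (div_ne_zero hy hx)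
    set t := b * X⁻¹ * X⁻¹ with ht
    have hb' : b = X * X * t := by rw [ht, mul_comm (X * X)]; group
    have hst : sy (Z * Z * a) t = 0 := by
      apply sy_steinberg
      have : (t : F) = 1 + (y / x) ^ 2 * a := by
        simp [ht, hxy, X]; field_simp
      rw [this]
      simp only [Units.val_mul, Z, Units.val_mk0]
      have h2 := CharTwo.add_self_eq_zero ((y / x) ^ 2 * (a : F))
      linear_combination h2
    rw [sy_mul_left, sy_mul_left] at hst
    refine ⟨a, X, Z⁻¹, t, ?_⟩
    have h3 : sy a t = -(sy Z t + sy Z t) := eq_neg_of_add_eq_zero_right hst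
    rw [hb', sy_mul_right, sy_mul_right, sy_inv_left, h3, two_smul]; abel

theorem main4 (n : ℕ) (w : K F 2) (α β γ δ : Fˣ)
    (hlift : (QuotientAddGroup.mk (2 • w) : KMod F 2 (n + 1)) =
      Milnor.symbol (n + 1) ![α, β] + Milnor.symbol (n + 1) ![γ, δ])
    (hexp : (2 ^ n) • Milnor.symbol (n + 1) ![α, β] = (0 : KMod F 2 (n + 1))) :
    ∃ u v : Fin 4 → Fˣ,
      (QuotientAddGroup.mk w : KMod F 2 n) = ∑ i, Milnor.symbol n ![u i, v i] := by
  have e1 : (2 ^ n) • sy α β ∈ modSub F 2 (n + 1) :=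
    (QuotientAddGroup.eq_zero_iff (N := modSub F 2 (n + 1)) _).1 hexp
  obtain ⟨y1, hy1⟩ := (mem_modSub _ _).1 e1
  obtain ⟨z1, hz1⟩ := forms_gen n _ _ hy1
  have e2 : 2 • w - (sy α β + sy γ δ) ∈ modSub F 2 (n + 1) :=
    (QuotientAddGroup.eq_zero_iff (N := modSub F 2 (n + 1)) _).1 (sub_eq_zero.2 hlift)
  obtain ⟨y2, hy2⟩ := (mem_modSub _ _).1 e2
  have hz2 : sy γ δ = 2 • (w - z1 - 2 ^ n • y2) := by
    rw [smul_sub, smul_sub, ← hz1, smul_smul, ← pow_succ', ← hy2]; abel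
  obtain ⟨a1, b1, a2, b2, hA⟩ := sy_two α β _ hz1
  obtain ⟨a3, b3, a4, b4, hB⟩ := sy_two γ δ _ hz2
  have h4 : 2 ^ 1 • (w - (sy a1 b1 + sy a2 b2 + (sy a3 b3 + sy a4 b4))) = 2 ^ (n + 1) • y2 := by
    rw [← hy2, hA, hB, pow_one, smul_sub, smul_add 2 (sy a1 b1 + sy a2 b2)]
  obtain ⟨t, ht⟩ := div_iter n 1 _ _ h4
  refine ⟨![a1, a2, a3, a4], ![b1, b2, b3, b4], ?_⟩
  have h5 := (QuotientAddGroup.eq_zero_iff (N := modSub F 2 n) _).2 ((mem_modSub _ _).2 ⟨t, ht⟩)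
  have h6 : (QuotientAddGroup.mk w : KMod F 2 n) = (symbol n ![a1, b1] + symbol n ![a2, b2] +
    (symbol n ![a3, b3] + symbol n ![a4, b4])) := sub_eq_zero.1 h5
  rw [h6, Fin.sum_univ_four]
  simp only [Matrix.cons_val]
  abel

end final
end Milnor



/-- if `ω ∈ K₂(F)/2ⁿK₂(F)` is such that its lift (under the
standard embedding, i.e. multiplication by 2 on representatives) to
`K₂(F)/2^{n+1}K₂(F)` is a sum of two symbols `{α,β} + {γ,δ}` with
`{α,β}_{2^{n+1}} ≠ 0` of exponent dividing `2ⁿ`, then `ω` is a sum of at most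
5 symbols in `K₂(F)/2ⁿK₂(F)`. -/
theorem stmt11 (F : Type*) [Field F] [CharP F 2] (n : ℕ) (hn : 1 ≤ n)
    (w : Milnor.K F 2) (α β γ δ : Fˣ)
    (hlift : (QuotientAddGroup.mk (2 • w) : KMod F 2 (n + 1)) =
      Milnor.symbol (n + 1) ![α, β] + Milnor.symbol (n + 1) ![γ, δ])
    (hne : Milnor.symbol (n + 1) ![α, β] ≠ (0 : KMod F 2 (n + 1)))
    (hexp : (2 ^ n) • Milnor.symbol (n + 1) ![α, β] = (0 : KMod F 2 (n + 1))) :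
    ∃ k : ℕ, k ≤ 5 ∧ ∃ u v : Fin k → Fˣ,
      (QuotientAddGroup.mk w : KMod F 2 n) = ∑ i, Milnor.symbol n ![u i, v i] := by
  obtain ⟨u, v, h⟩ := Milnor.main4 n w α β γ δ hlift hexp
  exact ⟨4, by norm_num, u, v, h⟩
end

section
/- Let F be a field of characteristic 2 and α, β, γ, a, b ∈ F× such that {α,β}₂ + {γ,δ}₂ + {a,b}₂ = 0 in K₂(F)/2K₂(F) for some δ ∈ F×. Then there exist c, d, e ∈ F× with {α,β}₂ = {c,d}₂, {γ,δ}₂ = {c,e}₂, and {a,b}₂ = {c,de}₂. -/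
open Milnor

set_option linter.unusedSectionVars false
namespace CS

variable {F : Type*} [Field F]

theorem s2_def {a b : F} (ha : a ≠ 0) (hb : b ≠ 0) :
    s2 1 a b = symbol 1 ![Units.mk0 a ha, Units.mk0 b hb] := by
  unfold s2
  rw [dif_pos ⟨ha, hb⟩]

theorem mk_rel {x : FreeAbelianGroup (Fin 2 → Fˣ)} (hx : x ∈ rels F 2) :
    (QuotientAddGroup.mk (QuotientAddGroup.mk x : K F 2) : KMod F 2 1) = 0 := by
  have h : (QuotientAddGroup.mk x : K F 2) = 0 := (QuotientAddGroup.eq_zero_iff x).2 hx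
  rw [h]; rfl

theorem s2_mul_left {a a' b : F} (ha : a ≠ 0) (ha' : a' ≠ 0) (hb : b ≠ 0) :
    s2 1 (a * a') b = s2 1 a b + s2 1 a' b := by
  rw [s2_def (mul_ne_zero ha ha') hb, s2_def ha hb, s2_def ha' hb]
  have := mk_rel (F := F) (AddSubgroup.subset_closure (Or.inl ⟨0, ![Units.mk0 a ha, Units.mk0 b hb],
    ![Units.mk0 a' ha', Units.mk0 b hb], ![Units.mk0 (a * a') (mul_ne_zero ha ha'), Units.mk0 b hb],
    by intro j hj; fin_cases j <;> simp_all, by ext; simp, rfl⟩))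
  have h2 : symbol 1 ![Units.mk0 (a * a') (mul_ne_zero ha ha'), Units.mk0 b hb]
    - symbol 1 ![Units.mk0 a ha, Units.mk0 b hb] - symbol 1 ![Units.mk0 a' ha', Units.mk0 b hb] = 0 := this
  rw [sub_sub, sub_eq_zero] at h2
  exact h2

theorem s2_mul_right {a b b' : F} (ha : a ≠ 0) (hb : b ≠ 0) (hb' : b' ≠ 0) :
    s2 1 a (b * b') = s2 1 a b + s2 1 a b' := by
  rw [s2_def ha (mul_ne_zero hb hb'), s2_def ha hb, s2_def ha hb']
  have := mk_rel (F := F) (AddSubgroup.subset_closure (Or.inl ⟨1, ![Units.mk0 a ha, Units.mk0 b hb],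
    ![Units.mk0 a ha, Units.mk0 b' hb'], ![Units.mk0 a ha, Units.mk0 (b * b') (mul_ne_zero hb hb')],
    by intro j hj; fin_cases j <;> simp_all, by ext; simp, rfl⟩))
  have h2 : symbol 1 ![Units.mk0 a ha, Units.mk0 (b * b') (mul_ne_zero hb hb')]
    - symbol 1 ![Units.mk0 a ha, Units.mk0 b hb] - symbol 1 ![Units.mk0 a ha, Units.mk0 b' hb'] = 0 := this
  rw [sub_sub, sub_eq_zero] at h2
  exact h2

theorem s2_steinberg {a b : F} (ha : a ≠ 0) (hb : b ≠ 0) (h : a + b = 1) : s2 1 a b = 0 := by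
  rw [s2_def ha hb]
  exact mk_rel (F := F) (AddSubgroup.subset_closure (Or.inr ⟨0, 1, ![Units.mk0 a ha, Units.mk0 b hb],
    by simp, by simpa using h, rfl⟩))

theorem add_self (x : KMod F 2 1) : x + x = 0 := by
  obtain ⟨y, rfl⟩ := QuotientAddGroup.mk_surjective x
  have : (QuotientAddGroup.mk (2 ^ 1 • y) : KMod F 2 1) = 0 :=
    (QuotientAddGroup.eq_zero_iff _).2 (AddSubgroup.subset_closure ⟨y, rfl⟩)
  rw [pow_one, two_nsmul] at this
  exact this

theorem eq_of_add {x y : KMod F 2 1} (h : x + y = 0) : x = y := by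
  rw [← add_self y] at h
  exact add_right_cancel h

theorem s2_one_right {a : F} (ha : a ≠ 0) : s2 1 a 1 = 0 := by
  have := s2_mul_right ha one_ne_zero (one_ne_zero (α := F))
  rw [mul_one, add_self] at this
  exact this

theorem s2_one_left {a : F} (ha : a ≠ 0) : s2 1 1 a = 0 := by
  have := s2_mul_left one_ne_zero (one_ne_zero (α := F)) ha
  rw [mul_one, add_self] at this
  exact this

theorem s2_sq_right {a b : F} (ha : a ≠ 0) (hb : b ≠ 0) : s2 1 a (b ^ 2) = 0 := by
  rw [sq, s2_mul_right ha hb hb, add_self]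

theorem s2_sq_left {a b : F} (ha : a ≠ 0) (hb : b ≠ 0) : s2 1 (a ^ 2) b = 0 := by
  rw [sq, s2_mul_left ha ha hb, add_self]

theorem s2_inv_right {a b : F} (ha : a ≠ 0) (hb : b ≠ 0) : s2 1 a b⁻¹ = s2 1 a b := by
  apply eq_of_add
  rw [← s2_mul_right ha (inv_ne_zero hb) hb, inv_mul_cancel₀ hb, s2_one_right ha]

theorem s2_inv_left {a b : F} (ha : a ≠ 0) (hb : b ≠ 0) : s2 1 a⁻¹ b = s2 1 a b := by
  apply eq_of_add
  rw [← s2_mul_left (inv_ne_zero ha) ha hb, inv_mul_cancel₀ ha, s2_one_left hb]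

theorem ne_of_s2 {a b : F} (h : s2 1 a b ≠ 0) : a ≠ 0 ∧ b ≠ 0 := by
  by_contra hc
  apply h
  unfold s2
  rw [dif_neg hc]

variable [CharP F 2]

theorem two0 : (2 : F) = 0 := CharTwo.two_eq_zero

theorem s2_self {a : F} (ha : a ≠ 0) : s2 1 a a = 0 := by
  by_cases h1 : a = 1
  · subst h1; exact s2_one_right ha
  have h2 : 1 + a ≠ 0 := fun h => h1 (by linear_combination h - two0 (F := F))
  have e1 : s2 1 a (1 + a) = 0 := s2_steinberg ha h2 (by linear_combination a * two0 (F := F))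
  have h3 : 1 + a⁻¹ = (1 + a) * a⁻¹ := by field_simp; ring
  have h4 : 1 + a⁻¹ ≠ 0 := by rw [h3]; exact mul_ne_zero h2 (inv_ne_zero ha)
  have e2 : s2 1 a⁻¹ (1 + a⁻¹) = 0 :=
    s2_steinberg (inv_ne_zero ha) h4 (by linear_combination a⁻¹ * two0 (F := F))
  rw [s2_inv_left ha h4, h3, s2_mul_right ha h2 (inv_ne_zero ha), e1, zero_add, s2_inv_right ha ha] at e2
  exact e2

theorem s2_comm {a b : F} (ha : a ≠ 0) (hb : b ≠ 0) : s2 1 a b = s2 1 b a := by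
  apply eq_of_add
  have := s2_self (mul_ne_zero ha hb)
  rw [s2_mul_left ha hb (mul_ne_zero ha hb), s2_mul_right ha ha hb, s2_mul_right hb ha hb,
    s2_self ha, s2_self hb, zero_add, add_zero] at this
  exact this

/-- `{x,y} = {x+y, xy}`. -/
theorem s2_add {x y : F} (hx : x ≠ 0) (hy : y ≠ 0) (hz : x + y ≠ 0) :
    s2 1 x y = s2 1 (x + y) (x * y) := by
  apply eq_of_add
  have h : s2 1 (x * (x + y)⁻¹) (y * (x + y)⁻¹) = 0 :=
    s2_steinberg (mul_ne_zero hx (inv_ne_zero hz)) (mul_ne_zero hy (inv_ne_zero hz)) (by field_simp)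
  rw [s2_mul_left hx (inv_ne_zero hz) (mul_ne_zero hy (inv_ne_zero hz)),
    s2_mul_right hx hy (inv_ne_zero hz), s2_mul_right (inv_ne_zero hz) hy (inv_ne_zero hz),
    s2_self (inv_ne_zero hz), s2_inv_right hx hz, s2_inv_left hz hy, add_zero, s2_comm hx hz] at h
  rw [s2_mul_right hz hx hy, ← add_assoc]
  exact h

theorem s2_sqmul_right {a b r : F} (ha : a ≠ 0) (hb : b ≠ 0) (hr : r ≠ 0) :
    s2 1 a (r ^ 2 * b) = s2 1 a b := by
  rw [s2_mul_right ha (pow_ne_zero 2 hr) hb, s2_sq_right ha hr, zero_add]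

theorem s2_sqmul_left {a b r : F} (ha : a ≠ 0) (hb : b ≠ 0) (hr : r ≠ 0) :
    s2 1 (r ^ 2 * a) b = s2 1 a b := by
  rw [s2_mul_left (pow_ne_zero 2 hr) ha hb, s2_sq_left hr hb, zero_add]

/-- norm-type vanishing -/
theorem s2_norm {a r s : F} (ha : a ≠ 0) (h : r ^ 2 + s ^ 2 * a ≠ 0) :
    s2 1 a (r ^ 2 + s ^ 2 * a) = 0 := by
  by_cases hr : r = 0
  · subst hr
    have hs : s ≠ 0 := by rintro rfl; simp at h
    rw [zero_pow two_ne_zero, zero_add, s2_sqmul_right ha ha hs, s2_self ha]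
  by_cases hs : s = 0
  · subst hs
    rw [zero_pow two_ne_zero, zero_mul, add_zero, s2_sq_right ha hr]
  have h1 := pow_ne_zero 2 hr
  have h2 := mul_ne_zero (pow_ne_zero 2 hs) ha
  have := s2_add h1 h2 h
  rw [s2_sq_left hr h2, s2_sqmul_right h h2 hr, s2_sqmul_right h ha hs] at this
  rw [s2_comm ha h, ← this]

theorem s2_pure {a b r s t c : F} (ha : a ≠ 0) (hb : b ≠ 0) (hc : c ≠ 0)
    (h : c = r ^ 2 * a + s ^ 2 * b + t ^ 2 * (a * b)) :
    ∃ d, d ≠ 0 ∧ s2 1 a b = s2 1 c d := by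
  by_cases hv : s ^ 2 + t ^ 2 * a = 0
  · have hc' : c = r ^ 2 * a := by rw [h]; linear_combination b * hv
    have hr : r ≠ 0 := by rintro rfl; simp at hc'; exact hc hc'
    exact ⟨b, hb, by rw [hc', s2_sqmul_left ha hb hr]⟩
  have hb' := mul_ne_zero hv hb
  have e : s2 1 a b = s2 1 a ((s ^ 2 + t ^ 2 * a) * b) := by
    rw [s2_mul_right ha hv hb, s2_norm ha hv, zero_add]
  have hc' : c = r ^ 2 * a + (s ^ 2 + t ^ 2 * a) * b := by rw [h]; ring
  rw [e]
  generalize (s ^ 2 + t ^ 2 * a) * b = b' at *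
  by_cases hr : r = 0
  · subst hr
    have : c = b' := by rw [hc']; ring
    exact ⟨a, ha, by rw [this, s2_comm ha hb']⟩
  · refine ⟨r ^ 2 * a * b', mul_ne_zero (mul_ne_zero (pow_ne_zero 2 hr) ha) hb', ?_⟩
    rw [hc', ← s2_add (mul_ne_zero (pow_ne_zero 2 hr) ha) hb' (by rw [← hc']; exact hc),
      s2_sqmul_left ha hb' hr]

/-! ### derivations and forms -/

/-- the value of `dlog a ∧ dlog b` on a pair of derivations -/
def form (D E : Derivation ℤ F F) (a b : F) : F := (D a * E b + D b * E a) / (a * b)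

theorem form_mul_left (D E : Derivation ℤ F F) {a a' b : F} (ha : a ≠ 0) (ha' : a' ≠ 0) (hb : b ≠ 0) :
    form D E (a * a') b = form D E a b + form D E a' b := by
  simp only [form, Derivation.leibniz, smul_eq_mul]
  field_simp
  ring

theorem form_comm (D E : Derivation ℤ F F) (a b : F) : form D E a b = form D E b a := by
  simp only [form]
  rw [mul_comm a b, add_comm]

theorem form_mul_right (D E : Derivation ℤ F F) {a b b' : F} (ha : a ≠ 0) (hb : b ≠ 0) (hb' : b' ≠ 0) :
    form D E a (b * b') = form D E a b + form D E a b' := by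
  rw [form_comm, form_mul_left D E hb hb' ha, form_comm D E b, form_comm D E b']

theorem form_steinberg (D E : Derivation ℤ F F) {a b : F} (h : a + b = 1) : form D E a b = 0 := by
  have hb : b = 1 - a := by linear_combination h
  subst hb
  simp only [form, map_sub, Derivation.map_one_eq_zero]
  rw [div_eq_zero_iff]
  left
  linear_combination - D a * E a * two0 (F := F)

noncomputable def formFree (D E : Derivation ℤ F F) : FreeAbelianGroup (Fin 2 → Fˣ) →+ F :=
  FreeAbelianGroup.lift (fun u : Fin 2 → Fˣ => form D E (u 0 : F) (u 1 : F))

theorem formFree_of (D E : Derivation ℤ F F) (u : Fin 2 → Fˣ) :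
    formFree D E (FreeAbelianGroup.of u) = form D E (u 0 : F) (u 1 : F) := by
  unfold formFree
  rw [FreeAbelianGroup.lift_apply_of]

theorem formFree_rels (D E : Derivation ℤ F F) : rels F 2 ≤ (formFree D E).ker := by
  unfold rels
  rw [AddSubgroup.closure_le]
  intro x hx
  rcases hx with h | h
  · obtain ⟨i, u, v, w, h1, h2, rfl⟩ := h
    rw [SetLike.mem_coe, AddMonoidHom.mem_ker, map_sub, map_sub, formFree_of, formFree_of, formFree_of]
    rw [sub_sub, sub_eq_zero]
    fin_cases i
    · obtain ⟨h3, h4⟩ := h1 1 (by simp)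
      simp only [Fin.zero_eta] at h2
      rw [h2, ← h3, ← h4, Units.val_mul, form_mul_left] <;> simp
    · obtain ⟨h3, h4⟩ := h1 0 (by simp)
      simp only [Fin.mk_one] at h2
      rw [h2, ← h3, ← h4, Units.val_mul, form_mul_right] <;> simp
  · obtain ⟨i, j, u, hij, h, rfl⟩ := h
    rw [SetLike.mem_coe, AddMonoidHom.mem_ker, formFree_of]
    fin_cases i <;> fin_cases j <;> simp at hij h ⊢
    · exact form_steinberg D E h
    · rw [form_comm]; exact form_steinberg D E h

noncomputable def formK (D E : Derivation ℤ F F) : K F 2 →+ F :=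
  QuotientAddGroup.lift (rels F 2) (formFree D E) (formFree_rels D E)

theorem formK_modSub (D E : Derivation ℤ F F) : modSub F 2 1 ≤ (formK D E).ker := by
  unfold modSub
  rw [AddSubgroup.closure_le]
  intro x hx
  obtain ⟨y, rfl⟩ := hx
  rw [SetLike.mem_coe, AddMonoidHom.mem_ker, map_nsmul, pow_one, two_nsmul, CharTwo.add_self_eq_zero]

noncomputable def formHom (D E : Derivation ℤ F F) : KMod F 2 1 →+ F :=
  QuotientAddGroup.lift (modSub F 2 1) (formK D E) (formK_modSub D E)

theorem formHom_s2 (D E : Derivation ℤ F F) {a b : F} (ha : a ≠ 0) (hb : b ≠ 0) :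
    formHom D E (s2 1 a b) = form D E a b := by
  rw [s2_def ha hb]
  have : formHom D E (symbol 1 ![Units.mk0 a ha, Units.mk0 b hb]) =
    formFree D E (FreeAbelianGroup.of ![Units.mk0 a ha, Units.mk0 b hb]) := rfl
  rw [this, formFree_of]
  simp

theorem form_sum {α β γ δ a b : F} (hα : α ≠ 0) (hβ : β ≠ 0) (hγ : γ ≠ 0) (hδ : δ ≠ 0)
    (ha : a ≠ 0) (hb : b ≠ 0)
    (hsum : s2 1 α β + s2 1 γ δ + s2 1 a b = (0 : KMod F 2 1)) (D E : Derivation ℤ F F) :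
    form D E α β + form D E γ δ + form D E a b = 0 := by
  have := congrArg (formHom D E) hsum
  rwa [map_add, map_add, map_zero, formHom_s2 D E hα hβ, formHom_s2 D E hγ hδ, formHom_s2 D E ha hb] at this

/-! ### fields between `F²` and `F` -/

variable (F) in
/-- the subfield of squares -/
def k0 : Subfield F := (frobenius F 2).fieldRange

theorem mem_k0 {x : F} : x ∈ k0 F ↔ ∃ r, x = r ^ 2 := by
  unfold k0
  rw [RingHom.mem_fieldRange]
  simp only [frobenius_def]
  exact ⟨fun ⟨r, h⟩ => ⟨r, h.symm⟩, fun ⟨r, h⟩ => ⟨r, h.symm⟩⟩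

theorem sq_mem_k0 (x : F) : x ^ 2 ∈ k0 F := mem_k0.2 ⟨x, rfl⟩

/-- `K(y)` -/
def adj (K : Subfield F) (y : F) : Subfield F := K ⊔ Subfield.closure {y}

theorem le_adj (K : Subfield F) (y : F) : K ≤ adj K y := le_sup_left

theorem self_mem_adj (K : Subfield F) (y : F) : y ∈ adj K y :=
  (le_sup_right : _ ≤ adj K y) (Subfield.subset_closure rfl)

theorem adj_comm (K : Subfield F) (x y : F) : adj (adj K x) y = adj (adj K y) x := by
  unfold adj
  exact sup_right_comm _ _ _

theorem adj_le {K M : Subfield F} {y : F} (h : K ≤ M) (hy : y ∈ M) : adj K y ≤ M := by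
  unfold adj
  refine sup_le h ?_
  rw [Subfield.closure_le]
  simpa using hy

/-- explicit model of `K(y)` -/
def adjModel (K : Subfield F) (hK : k0 F ≤ K) (y : F) : Subfield F where
  carrier := {x | ∃ m ∈ K, ∃ n ∈ K, x = m + n * y}
  mul_mem' := by
    rintro _ _ ⟨m, hm, n, hn, rfl⟩ ⟨m', hm', n', hn', rfl⟩
    exact ⟨m * m' + n * n' * y ^ 2, add_mem (mul_mem hm hm')
      (mul_mem (mul_mem hn hn') (hK (sq_mem_k0 y))), m * n' + n * m',
      add_mem (mul_mem hm hn') (mul_mem hn hm'), by ring⟩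
  one_mem' := ⟨1, one_mem K, 0, zero_mem K, by ring⟩
  add_mem' := by
    rintro _ _ ⟨m, hm, n, hn, rfl⟩ ⟨m', hm', n', hn', rfl⟩
    exact ⟨m + m', add_mem hm hm', n + n', add_mem hn hn', by ring⟩
  zero_mem' := ⟨0, zero_mem K, 0, zero_mem K, by ring⟩
  neg_mem' := by
    rintro _ ⟨m, hm, n, hn, rfl⟩
    exact ⟨-m, neg_mem hm, -n, neg_mem hn, by ring⟩
  inv_mem' := by
    rintro _ ⟨m, hm, n, hn, rfl⟩
    by_cases h : m + n * y = 0
    · rw [h, inv_zero]; exact ⟨0, zero_mem K, 0, zero_mem K, by ring⟩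
    · have h2 : ((m + n * y)⁻¹) ^ 2 ∈ K := hK (sq_mem_k0 _)
      exact ⟨((m + n * y)⁻¹) ^ 2 * m, mul_mem h2 hm, ((m + n * y)⁻¹) ^ 2 * n, mul_mem h2 hn, by
        field_simp⟩

theorem mem_adj {K : Subfield F} (hK : k0 F ≤ K) {x y : F} (h : x ∈ adj K y) :
    ∃ m ∈ K, ∃ n ∈ K, x = m + n * y := by
  have : adj K y ≤ adjModel K hK y :=
    adj_le (fun m hm => ⟨m, hm, 0, zero_mem K, by ring⟩) ⟨0, zero_mem K, 1, one_mem K, by ring⟩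
  exact this h

theorem k0_le_adj {K : Subfield F} (hK : k0 F ≤ K) (y : F) : k0 F ≤ adj K y := hK.trans (le_adj K y)

theorem exch {K : Subfield F} (hK : k0 F ≤ K) {x y : F} (hy : y ∉ K) (hx : x ∉ adj K y) :
    y ∉ adj K x := by
  intro h
  obtain ⟨m, hm, n, hn, e⟩ := mem_adj hK h
  have hn0 : n ≠ 0 := by
    rintro rfl
    apply hy
    rw [e]; simpa using hm
  apply hx
  have : x = (y - m) / n := by field_simp; linear_combination -e
  rw [this]
  exact div_mem (sub_mem (self_mem_adj K y) (le_adj K y hm)) (le_adj K y hn)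

theorem der_sq (D : Derivation ℤ F F) (x : F) : D (x ^ 2) = 0 := by
  rw [sq, D.leibniz, smul_eq_mul, CharTwo.add_self_eq_zero]

theorem der_k0 (D : Derivation ℤ F F) {x : F} (hx : x ∈ k0 F) : D x = 0 := by
  obtain ⟨r, rfl⟩ := mem_k0.1 hx
  exact der_sq D r

theorem der_adj (D : Derivation ℤ F F) {K : Subfield F} (hK : k0 F ≤ K) (h : ∀ x ∈ K, D x = 0) {y : F}
    (hy : D y = 0) : ∀ x ∈ adj K y, D x = 0 := by
  intro x hx
  obtain ⟨m, hm, n, hn, rfl⟩ := mem_adj hK hx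
  rw [map_add, D.leibniz, h m hm, h n hn, hy]
  simp

/-- existence of derivations -/
theorem exists_der {K : Subfield F} (hK : k0 F ≤ K) {x : F} (hx : x ∉ K) :
    ∃ D : Derivation ℤ F F, (∀ y ∈ K, D y = 0) ∧ D x = 1 := by
  obtain ⟨M, hKM, hM⟩ := zorn_le_nonempty₀ {M : Subfield F | x ∉ M} (by
    intro c hc hchain y hy
    refine ⟨sSup c, ?_, fun z hz => le_sSup hz⟩
    intro h
    rw [Subfield.mem_sSup_of_directedOn ⟨y, hy⟩ hchain.directedOn] at h
    obtain ⟨s, hs, hxs⟩ := h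
    exact hc hs hxs) K hx
  have hxM : x ∉ M := hM.prop
  have hkM : k0 F ≤ M := hK.trans hKM
  have key : ∀ y : F, ∃ p : M × M, y = p.1 + p.2 * x := by
    intro y
    have hy : y ∈ adj M x := by
      by_cases hyM : y ∈ M
      · exact le_adj M x hyM
      · by_contra hc
        have h1 : x ∉ adj M y := exch hkM hxM hc
        have := hM.le_of_ge (y := adj M y) h1 (le_adj M y)
        exact hyM (this (self_mem_adj M y))
    obtain ⟨m, hm, n, hn, e⟩ := mem_adj hkM hy
    exact ⟨(⟨m, hm⟩, ⟨n, hn⟩), e⟩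
  have uniq : ∀ m n m' n' : M, (m : F) + n * x = m' + n' * x → n = n' := by
    intro m n m' n' h
    by_contra hne
    have h1 : (n : F) - n' ≠ 0 := fun h => hne (Subtype.ext (sub_eq_zero.1 h))
    apply hxM
    have : x = (m' - m) / (n - n') := by field_simp; linear_combination h
    rw [this]
    exact div_mem (sub_mem m'.2 m.2) (sub_mem n.2 n'.2)
  choose f hf using key
  have coef : ∀ (m n : M) (y : F), y = m + n * x → (f y).2 = n := fun m n y h =>
    uniq (f y).1 (f y).2 m n (by rw [← hf y, h])
  let L : F →+ F :=
    { toFun := fun y => ((f y).2 : F)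
      map_zero' := by rw [coef 0 0 0 (by simp)]; simp
      map_add' := by
        intro y z
        rw [coef ((f y).1 + (f z).1) ((f y).2 + (f z).2) (y + z) (by
          push_cast
          linear_combination hf y + hf z)]
        push_cast; rfl }
  have hL : ∀ y, L y = ((f y).2 : F) := fun y => rfl
  refine ⟨Derivation.mk' L.toIntLinearMap ?_, ?_, ?_⟩
  · intro y z
    simp only [AddMonoidHom.coe_toIntLinearMap, smul_eq_mul]
    have hx2 : x ^ 2 ∈ M := hkM (sq_mem_k0 x)
    rw [hL, hL, hL, coef ((f y).1 * (f z).1 + (f y).2 * (f z).2 * ⟨x ^ 2, hx2⟩)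
      ((f y).1 * (f z).2 + (f y).2 * (f z).1) (y * z) (by
        push_cast
        linear_combination z * hf y + ((f y).1 + (f y).2 * x) * hf z)]
    push_cast
    linear_combination -(f z).2 * hf y - (f y).2 * hf z - (f y).2 * (f z).2 * x * two0 (F := F)
  · intro y hy
    change L y = 0
    rw [hL, coef ⟨y, hKM hy⟩ 0 y (by simp)]
    simp
  · change L x = 1
    rw [hL, coef 0 1 x (by simp)]
    simp

/-! ### nonzero symbols -/

theorem mem_adj_k0 {x y : F} (h : x ∈ adj (k0 F) y) : ∃ r s, x = r ^ 2 + s ^ 2 * y := by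
  obtain ⟨m, hm, n, hn, e⟩ := mem_adj le_rfl h
  obtain ⟨r, rfl⟩ := mem_k0.1 hm
  obtain ⟨s, rfl⟩ := mem_k0.1 hn
  exact ⟨r, s, e⟩

theorem mem_adj_adj_k0 {x y z : F} (h : x ∈ adj (adj (k0 F) y) z) :
    ∃ r s t u, x = r ^ 2 + s ^ 2 * y + t ^ 2 * z + u ^ 2 * (y * z) := by
  obtain ⟨m, hm, n, hn, e⟩ := mem_adj (le_adj _ _) h
  obtain ⟨r, s, rfl⟩ := mem_adj_k0 hm
  obtain ⟨t, u, rfl⟩ := mem_adj_k0 hn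
  exact ⟨r, s, t, u, by rw [e]; ring⟩

theorem indep_right {a b : F} (h : s2 1 a b ≠ 0) : b ∉ adj (k0 F) a := by
  intro hb
  obtain ⟨h1, h2⟩ := ne_of_s2 h
  obtain ⟨r, s, rfl⟩ := mem_adj_k0 hb
  exact h (s2_norm h1 h2)

theorem indep_left {a b : F} (h : s2 1 a b ≠ 0) : a ∉ adj (k0 F) b := by
  obtain ⟨h1, h2⟩ := ne_of_s2 h
  rw [s2_comm h1 h2] at h
  exact indep_right h

theorem indep_one {a b : F} (h : s2 1 a b ≠ 0) : a ∉ k0 F := fun hc => indep_left h (le_adj _ _ hc)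

/-- common slot when both symbols live in the same field -/
theorem equal_case {α β γ δ : F} (h1 : s2 1 α β ≠ 0) (h2 : s2 1 γ δ ≠ 0)
    (hγ : γ ∈ adj (adj (k0 F) α) β) (hδ : δ ∈ adj (adj (k0 F) α) β) :
    ∃ c d e, c ≠ 0 ∧ d ≠ 0 ∧ e ≠ 0 ∧ s2 1 α β = s2 1 c d ∧ s2 1 γ δ = s2 1 c e := by
  obtain ⟨hα0, hβ0⟩ := ne_of_s2 h1
  obtain ⟨hγ0, hδ0⟩ := ne_of_s2 h2
  obtain ⟨x0, x1, x2, x3, ex⟩ := mem_adj_adj_k0 hγ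
  obtain ⟨y0, y1, y2, y3, ey⟩ := mem_adj_adj_k0 hδ
  by_cases hx : x0 = 0
  · obtain ⟨d, hd, e⟩ := s2_pure (r := x1) (s := x2) (t := x3) hα0 hβ0 hγ0 (by rw [ex, hx]; ring)
    exact ⟨γ, d, δ, hγ0, hd, hδ0, e, rfl⟩
  · have hc : y0 ^ 2 * γ + x0 ^ 2 * δ ≠ 0 := by
      intro hc
      apply indep_right h2
      have : δ = -(y0 ^ 2 * γ) / x0 ^ 2 := by field_simp; linear_combination hc
      rw [this]
      exact div_mem (neg_mem (mul_mem (le_adj _ _ (sq_mem_k0 _)) (self_mem_adj _ _)))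
        (le_adj _ _ (sq_mem_k0 _))
    obtain ⟨d, hd, e⟩ := s2_pure (r := y0 * x1 + x0 * y1) (s := y0 * x2 + x0 * y2)
      (t := y0 * x3 + x0 * y3) hα0 hβ0 hc (by
        rw [ex, ey]
        linear_combination (x0 ^ 2 * y0 ^ 2 - y0 * x1 * x0 * y1 * α - y0 * x2 * x0 * y2 * β
          - y0 * x3 * x0 * y3 * (α * β)) * two0 (F := F))
    obtain ⟨e', he', e2⟩ := s2_pure (r := y0) (s := x0) (t := 0) hγ0 hδ0 hc (by ring)
    exact ⟨_, d, e', hc, hd, he', e, e2⟩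

/-! ### the main argument -/

theorem exists_dual {α β δ : F} (hα : α ∉ k0 F) (hβ : β ∉ adj (k0 F) α)
    (hδ : δ ∉ adj (adj (k0 F) α) β) :
    ∃ d1 d2 d3 : Derivation ℤ F F, (d1 α = 1 ∧ d1 β = 0 ∧ d1 δ = 0) ∧
      (d2 α = 0 ∧ d2 β = 1 ∧ d2 δ = 0) ∧ (d3 α = 0 ∧ d3 β = 0 ∧ d3 δ = 1) := by
  have h2 : β ∉ adj (adj (k0 F) α) δ := exch (le_adj _ _) hβ hδ
  have hα' : α ∉ adj (k0 F) β := exch le_rfl hα hβ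
  have h1 : α ∉ adj (adj (k0 F) β) δ := exch (le_adj _ _) hα' (by rwa [adj_comm])
  obtain ⟨d1, h1, e1⟩ := exists_der (k0_le_adj (le_adj _ _) _) h1
  obtain ⟨d2, h2, e2⟩ := exists_der (k0_le_adj (le_adj _ _) _) h2
  obtain ⟨d3, h3, e3⟩ := exists_der (k0_le_adj (le_adj _ _) _) hδ
  exact ⟨d1, d2, d3, ⟨e1, h1 _ (le_adj _ _ (self_mem_adj _ _)), h1 _ (self_mem_adj _ _)⟩,
    ⟨h2 _ (le_adj _ _ (self_mem_adj _ _)), e2, h2 _ (self_mem_adj _ _)⟩,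
    ⟨h3 _ (le_adj _ _ (self_mem_adj _ _)), h3 _ (self_mem_adj _ _), e3⟩⟩

theorem plucker {α β γ δ a b : F} (hα0 : α ≠ 0) (hβ0 : β ≠ 0) (hγ0 : γ ≠ 0) (hδ0 : δ ≠ 0)
    (ha0 : a ≠ 0) (hb0 : b ≠ 0)
    (hα : α ∉ k0 F) (hβ : β ∉ adj (k0 F) α) (hδ : δ ∉ adj (adj (k0 F) α) β)
    (hω : ∀ D E : Derivation ℤ F F, form D E α β + form D E γ δ + form D E a b = 0) :
    γ ∈ adj (adj (adj (k0 F) α) β) δ := by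
  by_contra hγ
  have h2 : β ∉ adj (adj (k0 F) α) δ := exch (le_adj _ _) hβ hδ
  have hα' : α ∉ adj (k0 F) β := exch le_rfl hα hβ
  have h1 : α ∉ adj (adj (k0 F) β) δ := exch (le_adj _ _) hα' (by rwa [adj_comm])
  have g1 : α ∉ adj (adj (adj (k0 F) β) δ) γ := exch (k0_le_adj (le_adj _ _) _) h1 (by
    rw [adj_comm _ δ α, adj_comm _ β α]; exact hγ)
  have g2 : β ∉ adj (adj (adj (k0 F) α) δ) γ := exch (k0_le_adj (le_adj _ _) _) h2 (by
    rw [adj_comm _ δ β]; exact hγ)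
  have g3 : δ ∉ adj (adj (adj (k0 F) α) β) γ := exch (k0_le_adj (le_adj _ _) _) hδ hγ
  obtain ⟨d1, h1, e1⟩ := exists_der (k0_le_adj (k0_le_adj (le_adj _ _) _) _) g1
  obtain ⟨d2, h2, e2⟩ := exists_der (k0_le_adj (k0_le_adj (le_adj _ _) _) _) g2
  obtain ⟨d3, h3, e3⟩ := exists_der (k0_le_adj (k0_le_adj (le_adj _ _) _) _) g3
  obtain ⟨d4, h4, e4⟩ := exists_der (k0_le_adj (k0_le_adj (le_adj _ _) _) _) hγ
  have m1 : ∀ x y z : F, x ∈ adj (adj (adj (k0 F) x) y) z := fun x y z =>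
    le_adj _ _ (le_adj _ _ (self_mem_adj _ _))
  have m2 : ∀ x y z : F, y ∈ adj (adj (adj (k0 F) x) y) z := fun x y z =>
    le_adj _ _ (self_mem_adj _ _)
  have m3 : ∀ x y z : F, z ∈ adj (adj (adj (k0 F) x) y) z := fun x y z => self_mem_adj _ _
  have a1 := h1 _ (m1 _ _ _)
  have a2 := h1 _ (m2 _ _ _)
  have a3 := h1 _ (m3 _ _ _)
  have b1 := h2 _ (m1 _ _ _)
  have b2 := h2 _ (m2 _ _ _)
  have b3 := h2 _ (m3 _ _ _)
  have c1 := h3 _ (m1 _ _ _)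
  have c2 := h3 _ (m2 _ _ _)
  have c3 := h3 _ (m3 _ _ _)
  have f1 := h4 _ (m1 _ _ _)
  have f2 := h4 _ (m2 _ _ _)
  have f3 := h4 _ (m3 _ _ _)
  have w12 := hω d1 d2
  have w13 := hω d1 d3
  have w14 := hω d1 d4
  have w23 := hω d2 d3
  have w24 := hω d2 d4
  have w34 := hω d3 d4
  simp only [form, e1, e2, e3, e4, a1, a2, a3, b1, b2, b3, c1, c2, c3, f1, f2, f3, mul_zero,
    add_zero, zero_add, mul_one, zero_div] at w12 w13 w14 w23 w24 w34
  have hab := mul_ne_zero ha0 hb0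
  rw [div_eq_zero_iff, or_iff_left hab] at w13 w14 w23 w24
  have p12 : d1 a * d2 b + d1 b * d2 a ≠ 0 := by
    intro h
    rw [h, zero_div, add_zero] at w12
    exact one_div_ne_zero (mul_ne_zero hα0 hβ0) w12
  have p34 : d3 a * d4 b + d3 b * d4 a ≠ 0 := by
    intro h
    rw [h, zero_div, add_zero] at w34
    exact one_div_ne_zero (mul_ne_zero hγ0 hδ0) w34
  apply mul_ne_zero p12 p34
  linear_combination (d2 a * d4 b + d2 b * d4 a) * w13 + (d2 a * d3 b + d2 b * d3 a) * w14
    - (d1 a * d2 a * d3 b * d4 b + d1 b * d2 b * d3 a * d4 a) * two0 (F := F)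

theorem chain {α β δ : F} {d1 d2 d3 : Derivation ℤ F F} (h1 : d1 α = 1 ∧ d1 β = 0 ∧ d1 δ = 0)
    (h2 : d2 α = 0 ∧ d2 β = 1 ∧ d2 δ = 0) (h3 : d3 α = 0 ∧ d3 β = 0 ∧ d3 δ = 1)
    (D : Derivation ℤ F F) {f : F} (hf : f ∈ adj (adj (adj (k0 F) α) β) δ) :
    D f = d1 f * D α + d2 f * D β + d3 f * D δ := by
  have := der_adj (D - D α • d1 - D β • d2 - D δ • d3) (k0_le_adj (le_adj _ _) _)
    (der_adj _ (le_adj _ _) (der_adj _ le_rfl (fun x hx => der_k0 _ hx) (by simp [h1, h2, h3]))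
      (by simp [h1, h2, h3])) (by simp [h1, h2, h3]) f hf
  simp only [Derivation.sub_apply, Derivation.smul_apply, smul_eq_mul] at this
  linear_combination this

theorem lemX {α β γ δ a b : F} (hα0 : α ≠ 0) (hβ0 : β ≠ 0) (hγ0 : γ ≠ 0) (hδ0 : δ ≠ 0)
    (hab : s2 1 a b ≠ 0) {d1 d2 d3 : Derivation ℤ F F} (h1 : d1 α = 1 ∧ d1 β = 0 ∧ d1 δ = 0)
    (h2 : d2 α = 0 ∧ d2 β = 1 ∧ d2 δ = 0) (h3 : d3 α = 0 ∧ d3 β = 0 ∧ d3 δ = 1)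
    (hγ : γ ∈ adj (adj (adj (k0 F) α) β) δ)
    (hω : ∀ D E : Derivation ℤ F F, form D E α β + form D E γ δ + form D E a b = 0)
    {A B : F} (hA : A = α * β * d2 γ / γ) (hB : B = α * β * d1 γ / γ) :
    A * d1 A + B * d2 A + δ * d3 A = A ∧ A * d1 B + B * d2 B + δ * d3 B = B := by
  obtain ⟨ha0, hb0⟩ := ne_of_s2 hab
  have hk := k0_le_adj (le_adj (k0 F) a) b
  have hk1 := k0_le_adj hk δ
  obtain ⟨D, hD⟩ : ∃ D : Derivation ℤ F F, D = A • d1 + B • d2 + δ • d3 := ⟨_, rfl⟩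
  have hDx : ∀ x, D x = A * d1 x + B * d2 x + δ * d3 x := by
    intro x; rw [hD]; simp
  have Dα : D α = A := by rw [hDx, h1.1, h2.1, h3.1]; ring
  have Dβ : D β = B := by rw [hDx, h1.2.1, h2.2.1, h3.2.1]; ring
  have Dδ : D δ = δ := by rw [hDx, h1.2.2, h2.2.2, h3.2.2]; ring
  have hz : ∀ E, form D E a b = 0 := by
    intro E
    have := hω D E
    have hs : form D E α β + form D E γ δ = 0 := by
      simp only [form, Dα, Dβ, Dδ]
      rw [hDx γ, chain h1 h2 h3 E hγ, hA, hB]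
      field_simp
      ring_nf
      simp [two0]
    rwa [hs, zero_add] at this
  have hz' : ∀ E : Derivation ℤ F F, D a * E b + D b * E a = 0 := by
    intro E
    have := hz E
    rwa [form, div_eq_zero_iff, or_iff_left (mul_ne_zero ha0 hb0)] at this
  have Da : D a = 0 := by
    obtain ⟨E, hE, hE1⟩ := exists_der (le_adj _ _) (indep_right hab)
    have := hz' E
    rw [hE1, hE a (self_mem_adj _ _)] at this
    linear_combination this
  have Db : D b = 0 := by
    obtain ⟨E, hE, hE1⟩ := exists_der (le_adj _ _) (indep_left hab)
    have := hz' E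
    rw [hE1, hE b (self_mem_adj _ _)] at this
    linear_combination this
  have Dab : ∀ x ∈ adj (adj (k0 F) a) b, D x = 0 :=
    der_adj D (le_adj _ _) (der_adj D le_rfl (fun x hx => der_k0 _ hx) Da) Db
  have key : ∀ x ∈ adj (adj (adj (k0 F) a) b) δ, D (D x) = D x := by
    intro x hx
    obtain ⟨m, hm, n, hn, rfl⟩ := mem_adj hk hx
    simp [Dab m hm, Dab n hn, Dδ]
  have hz3 : ∀ E E' : Derivation ℤ F F, (∀ y ∈ adj (adj (adj (k0 F) a) b) δ, E y = 0) →
      form E E' α β + form E E' γ δ = 0 := by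
    intro E E' hE
    have := hω E E'
    have e : form E E' a b = 0 := by
      rw [form, hE a (le_adj _ _ (le_adj _ _ (self_mem_adj _ _))),
        hE b (le_adj _ _ (self_mem_adj _ _))]
      simp
    rwa [e, add_zero] at this
  have mα : α ∈ adj (adj (adj (k0 F) a) b) δ := by
    by_contra hc
    obtain ⟨E, hE, hE1⟩ := exists_der hk1 hc
    have := hz3 E d2 hE
    simp [form, hE1, h2, hE δ (self_mem_adj _ _), hα0, hβ0] at this
  have mβ : β ∈ adj (adj (adj (k0 F) a) b) δ := by
    by_contra hc
    obtain ⟨E, hE, hE1⟩ := exists_der hk1 hc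
    have := hz3 E d1 hE
    simp [form, hE1, h1, hE δ (self_mem_adj _ _), hα0, hβ0] at this
  have kA := key α mα
  have kB := key β mβ
  rw [Dα, hDx] at kA
  rw [Dβ, hDx] at kB
  exact ⟨kA, kB⟩

/-- second use: `{α,β} + {α+t,δ}` is a symbol only for `t = 0`. -/
theorem shift_zero {α β t δ a b : F} (hα0 : α ≠ 0) (hβ0 : β ≠ 0) (hγ0 : α + t ≠ 0) (hδ0 : δ ≠ 0)
    (ht : t ∈ k0 F) (hab : s2 1 a b ≠ 0)
    (hα : α ∉ k0 F) (hβ : β ∉ adj (k0 F) α) (hδ : δ ∉ adj (adj (k0 F) α) β)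
    (hω : ∀ D E : Derivation ℤ F F, form D E α β + form D E (α + t) δ + form D E a b = 0) :
    t = 0 := by
  obtain ⟨d1, d2, d3, h1, h2, h3⟩ := exists_dual hα hβ hδ
  have hγ : α + t ∈ adj (adj (adj (k0 F) α) β) δ :=
    le_adj _ _ (le_adj _ _ (add_mem (self_mem_adj _ _) (le_adj _ _ ht)))
  have e1 : d1 (α + t) = 1 := by rw [map_add, h1.1, der_k0 d1 ht, add_zero]
  have e2 : d2 (α + t) = 0 := by rw [map_add, h2.1, der_k0 d2 ht, add_zero]
  have e3 : d3 (α + t) = 0 := by rw [map_add, h3.1, der_k0 d3 ht, add_zero]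
  obtain ⟨B, hB⟩ : ∃ B, B = α * β / (α + t) := ⟨_, rfl⟩
  have hBm : B * (α + t) = α * β := by rw [hB]; field_simp
  have hX := (lemX (A := 0) (B := B) hα0 hβ0 hγ0 hδ0 hab h1 h2 h3 hγ hω (by rw [e2]; simp)
    (by rw [e1, hB]; simp)).2
  have k2 := congrArg d2 hBm
  have k3 := congrArg d3 hBm
  simp only [Derivation.leibniz, smul_eq_mul, e2, e3, h2, h3] at k2 k3
  have hd3 : d3 B = 0 := by
    have : (α + t) * d3 B = 0 := by linear_combination k3
    exact (mul_eq_zero.1 this).resolve_left hγ0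
  rw [hd3] at hX
  have hB0 : B ≠ 0 := by rw [hB]; positivity
  have h4 : d2 B = 1 := by
    apply mul_left_cancel₀ hB0
    linear_combination hX
  rw [h4] at k2
  linear_combination k2

theorem find_c {α β γ δ a b : F} (h1 : s2 1 α β ≠ 0) (h2 : s2 1 γ δ ≠ 0) (hab : s2 1 a b ≠ 0)
    (hδ : δ ∉ adj (adj (k0 F) α) β)
    (hω : ∀ D E : Derivation ℤ F F, form D E α β + form D E γ δ + form D E a b = 0) :
    ∃ c, c ∈ adj (adj (k0 F) α) β ∧ c ∈ adj (adj (k0 F) γ) δ ∧ c ∉ k0 F := by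
  obtain ⟨hα0, hβ0⟩ := ne_of_s2 h1
  obtain ⟨hγ0, hδ0⟩ := ne_of_s2 h2
  obtain ⟨ha0, hb0⟩ := ne_of_s2 hab
  have hα := indep_one h1
  have hβ := indep_right h1
  have hγ := plucker hα0 hβ0 hγ0 hδ0 ha0 hb0 hα hβ hδ hω
  obtain ⟨d1, d2, d3, e1, e2, e3⟩ := exists_dual hα hβ hδ
  obtain ⟨p, hp, q, hq, e⟩ := mem_adj (k0_le_adj (le_adj _ _) _) hγ
  have mγ : γ ∈ adj (adj (k0 F) γ) δ := le_adj _ _ (self_mem_adj _ _)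
  have mδ : δ ∈ adj (adj (k0 F) γ) δ := self_mem_adj _ _
  have mk : ∀ x ∈ k0 F, x ∈ adj (adj (k0 F) γ) δ := fun x hx => le_adj _ _ (le_adj _ _ hx)
  by_cases hqk : q ∈ k0 F
  · refine ⟨p, hp, ?_, ?_⟩
    · have : p = γ - q * δ := by linear_combination -e
      rw [this]
      exact sub_mem mγ (mul_mem (mk _ hqk) mδ)
    · intro hpk
      apply indep_left h2
      rw [e]
      exact add_mem (le_adj _ _ hpk) (mul_mem (le_adj _ _ hqk) (self_mem_adj _ _))
  by_cases hpq : p ∈ adj (k0 F) q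
  · obtain ⟨x, hx, y, hy, epq⟩ := mem_adj le_rfl hpq
    refine ⟨q, hq, ?_, hqk⟩
    have hyδ : y + δ ≠ 0 := by
      intro h
      apply hδ
      have : δ = -y := by linear_combination h
      rw [this]
      exact neg_mem (le_adj _ _ (le_adj _ _ hy))
    have : q = (γ - x) / (y + δ) := by field_simp; linear_combination -e - epq
    rw [this]
    exact div_mem (sub_mem mγ (mk _ hx)) (add_mem (mk _ hy) mδ)
  exfalso
  have hqp : q ∉ adj (k0 F) p := exch le_rfl hqk hpq
  obtain ⟨E, hE, hE1⟩ := exists_der (le_adj _ _) hpq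
  obtain ⟨E', hE', hE1'⟩ := exists_der (le_adj _ _) hqp
  have hEq := hE q (self_mem_adj _ _)
  have hEp' := hE' p (self_mem_adj _ _)
  have hp' := le_adj _ δ hp
  have hq' := le_adj _ δ hq
  have zK1 : ∀ x ∈ adj (adj (k0 F) α) β, d3 x = 0 :=
    der_adj d3 (le_adj _ _) (der_adj d3 le_rfl (fun x hx => der_k0 _ hx) e3.1) e3.2.1
  rw [chain e1 e2 e3 E hp', zK1 p hp] at hE1
  rw [chain e1 e2 e3 E hq', zK1 q hq] at hEq
  rw [chain e1 e2 e3 E' hq', zK1 q hq] at hE1'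
  rw [chain e1 e2 e3 E' hp', zK1 p hp] at hEp'
  suffices h : d1 p * d2 q = d2 p * d1 q by
    apply one_ne_zero (α := F)
    linear_combination (E α * E' β - E β * E' α) * h - (d1 q * E' α + d2 q * E' β + 0 * E' δ) * hE1
      - hE1' + (d1 p * E' α + d2 p * E' β + 0 * E' δ) * hEq
  obtain ⟨r, s, t, u, ep⟩ := mem_adj_adj_k0 hp
  obtain ⟨r', s', t', u', eq⟩ := mem_adj_adj_k0 hq
  have p1 : d1 p = s ^ 2 + u ^ 2 * β := by
    rw [ep]; simp only [map_add, Derivation.leibniz, smul_eq_mul, der_sq, e1]; ring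
  have p2 : d2 p = t ^ 2 + u ^ 2 * α := by
    rw [ep]; simp only [map_add, Derivation.leibniz, smul_eq_mul, der_sq, e2]; ring
  have q1 : d1 q = s' ^ 2 + u' ^ 2 * β := by
    rw [eq]; simp only [map_add, Derivation.leibniz, smul_eq_mul, der_sq, e1]; ring
  have q2 : d2 q = t' ^ 2 + u' ^ 2 * α := by
    rw [eq]; simp only [map_add, Derivation.leibniz, smul_eq_mul, der_sq, e2]; ring
  obtain ⟨g1, hg1⟩ : ∃ g, g = d1 γ := ⟨_, rfl⟩
  obtain ⟨g2, hg2⟩ : ∃ g, g = d2 γ := ⟨_, rfl⟩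
  have G1 : g1 = s ^ 2 + u ^ 2 * β + (s' ^ 2 + u' ^ 2 * β) * δ := by
    rw [hg1, e]; simp only [map_add, Derivation.leibniz, smul_eq_mul, e1, p1, q1]; ring
  have G2 : g2 = t ^ 2 + u ^ 2 * α + (t' ^ 2 + u' ^ 2 * α) * δ := by
    rw [hg2, e]; simp only [map_add, Derivation.leibniz, smul_eq_mul, e2, p2, q2]; ring
  have g11 : d1 g1 = 0 := by
    rw [G1]; simp only [map_add, Derivation.leibniz, smul_eq_mul, der_sq, e1]; ring
  have g12 : d2 g1 = u ^ 2 + u' ^ 2 * δ := by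
    rw [G1]; simp only [map_add, Derivation.leibniz, smul_eq_mul, der_sq, e2]; ring
  have g13 : d3 g1 = d1 q := by
    rw [G1, q1]; simp only [map_add, Derivation.leibniz, smul_eq_mul, der_sq, e3]; ring
  have g21 : d1 g2 = u ^ 2 + u' ^ 2 * δ := by
    rw [G2]; simp only [map_add, Derivation.leibniz, smul_eq_mul, der_sq, e1]; ring
  have g22 : d2 g2 = 0 := by
    rw [G2]; simp only [map_add, Derivation.leibniz, smul_eq_mul, der_sq, e2]; ring
  have g23 : d3 g2 = d2 q := by
    rw [G2, q2]; simp only [map_add, Derivation.leibniz, smul_eq_mul, der_sq, e3]; ring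
  obtain ⟨A, hA⟩ : ∃ A, A = α * β * g2 / γ := ⟨_, rfl⟩
  obtain ⟨B, hB⟩ : ∃ B, B = α * β * g1 / γ := ⟨_, rfl⟩
  obtain ⟨XA, XB⟩ := lemX (A := A) (B := B) hα0 hβ0 hγ0 hδ0 hab e1 e2 e3 hγ hω (by rw [hA, hg2])
    (by rw [hB, hg1])
  have hAB : A * g1 = B * g2 := by rw [hA, hB]; ring
  have k1 := congrArg d1 hAB
  have k2 := congrArg d2 hAB
  have k3 := congrArg d3 hAB
  simp only [Derivation.leibniz, smul_eq_mul, g11, g12, g13, g21, g22, g23] at k1 k2 k3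
  have E1 : A * (B * (u ^ 2 + u' ^ 2 * δ) + δ * d1 q) = B * (A * (u ^ 2 + u' ^ 2 * δ) + δ * d2 q) := by
    linear_combination A * k1 + B * k2 + δ * k3 - g1 * XA + g2 * XB - hAB
  have hAγ : A * γ = α * β * g2 := by rw [hA]; field_simp
  have hBγ : B * γ = α * β * g1 := by rw [hB]; field_simp
  have E2 : (α * β * δ) * (g2 * d1 q - g1 * d2 q) = 0 := by
    linear_combination γ * E1 - δ * d1 q * hAγ + δ * d2 q * hBγ
  have E3 := (mul_eq_zero.1 E2).resolve_left (mul_ne_zero (mul_ne_zero hα0 hβ0) hδ0)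
  rw [G1, G2, ← p1, ← p2, ← q1, ← q2] at E3
  linear_combination -E3

theorem core' {α β γ δ a b : F} (h1 : s2 1 α β ≠ 0) (h2 : s2 1 γ δ ≠ 0) (hab : s2 1 a b ≠ 0)
    (hsum : s2 1 α β + s2 1 γ δ + s2 1 a b = (0 : KMod F 2 1))
    (hδ : δ ∉ adj (adj (k0 F) α) β) :
    ∃ c d e, c ≠ 0 ∧ d ≠ 0 ∧ e ≠ 0 ∧ s2 1 α β = s2 1 c d ∧ s2 1 γ δ = s2 1 c e := by
  obtain ⟨hα0, hβ0⟩ := ne_of_s2 h1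
  obtain ⟨hγ0, hδ0⟩ := ne_of_s2 h2
  obtain ⟨ha0, hb0⟩ := ne_of_s2 hab
  obtain ⟨c0, m1, m2, hc0⟩ := find_c h1 h2 hab hδ (form_sum hα0 hβ0 hγ0 hδ0 ha0 hb0 hsum)
  obtain ⟨r, s, t, u, e1⟩ := mem_adj_adj_k0 m1
  obtain ⟨r', s', t', u', e2⟩ := mem_adj_adj_k0 m2
  have hc : c0 - r ^ 2 ≠ 0 := fun h => hc0 (by rw [sub_eq_zero.1 h]; exact sq_mem_k0 r)
  have hc' : c0 - r' ^ 2 ≠ 0 := fun h => hc0 (by rw [sub_eq_zero.1 h]; exact sq_mem_k0 r')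
  obtain ⟨d, hd, ed⟩ := s2_pure (r := s) (s := t) (t := u) hα0 hβ0 hc (by rw [e1]; ring)
  obtain ⟨e, he, ee⟩ := s2_pure (r := s') (s := t') (t := u') hγ0 hδ0 hc' (by rw [e2]; ring)
  have h1' := h1
  have h2' := h2
  rw [ed] at h1'
  rw [ee] at h2'
  rw [ed, ee]
  have hT : r ^ 2 - r' ^ 2 ∈ k0 F := sub_mem (sq_mem_k0 _) (sq_mem_k0 _)
  have hcc : c0 - r' ^ 2 = (c0 - r ^ 2) + (r ^ 2 - r' ^ 2) := by ring
  by_cases hek : e ∈ adj (adj (k0 F) (c0 - r ^ 2)) d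
  · refine equal_case h1' h2' ?_ hek
    rw [hcc]
    exact le_adj _ _ (add_mem (self_mem_adj _ _) (le_adj _ _ hT))
  · rw [ed, ee] at hsum
    have hω := form_sum hc hd hc' he ha0 hb0 hsum
    rw [hcc] at hω hc' ⊢
    have := shift_zero hc hd hc' he hT hab (indep_one h1') (indep_right h1') hek hω
    rw [this, add_zero]
    exact ⟨_, d, e, hc, hd, he, rfl, rfl⟩

theorem core {α β γ δ a b : F} (h1 : s2 1 α β ≠ 0) (h2 : s2 1 γ δ ≠ 0) (hab : s2 1 a b ≠ 0)
    (hsum : s2 1 α β + s2 1 γ δ + s2 1 a b = (0 : KMod F 2 1)) :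
    ∃ c d e, c ≠ 0 ∧ d ≠ 0 ∧ e ≠ 0 ∧ s2 1 α β = s2 1 c d ∧ s2 1 γ δ = s2 1 c e := by
  by_cases hδ : δ ∈ adj (adj (k0 F) α) β
  · by_cases hγ : γ ∈ adj (adj (k0 F) α) β
    · exact equal_case h1 h2 hγ hδ
    · obtain ⟨hγ0, hδ0⟩ := ne_of_s2 h2
      rw [s2_comm hγ0 hδ0] at h2 hsum ⊢
      exact core' h1 h2 hab hsum hγ
  · exact core' h1 h2 hab hsum hδ

end CS

/-- common slot lemma for three symbols: if
`{α,β}₂ + {γ,δ}₂ + {a,b}₂ = 0`, then there are `c, d, e` with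
`{α,β}₂ = {c,d}₂`, `{γ,δ}₂ = {c,e}₂` and `{a,b}₂ = {c,de}₂`. -/
theorem stmt12 (F : Type*) [Field F] [CharP F 2] (α β γ δ a b : F)
    (hα : α ≠ 0) (hβ : β ≠ 0) (hγ : γ ≠ 0) (hδ : δ ≠ 0)
    (ha : a ≠ 0) (hb : b ≠ 0)
    (hsum : s2 1 α β + s2 1 γ δ + s2 1 a b = (0 : KMod F 2 1)) :
    ∃ c d e : F, c ≠ 0 ∧ d ≠ 0 ∧ e ≠ 0 ∧
      s2 1 α β = s2 1 c d ∧ s2 1 γ δ = s2 1 c e ∧ s2 1 a b = s2 1 c (d * e) := by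
  by_cases h1 : s2 1 α β = 0
  · rw [h1, zero_add] at hsum
    exact ⟨γ, 1, δ, hγ, one_ne_zero, hδ, by rw [h1, CS.s2_one_right hγ], rfl,
      by rw [one_mul, CS.eq_of_add hsum]⟩
  by_cases h2 : s2 1 γ δ = 0
  · rw [h2, add_zero] at hsum
    exact ⟨α, β, 1, hα, hβ, one_ne_zero, rfl, by rw [h2, CS.s2_one_right hα],
      by rw [mul_one, CS.eq_of_add hsum]⟩
  by_cases h3 : s2 1 a b = 0
  · rw [h3, add_zero] at hsum
    exact ⟨α, β, β, hα, hβ, hβ, rfl, (CS.eq_of_add hsum).symm,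
      by rw [h3, CS.s2_mul_right hα hβ hβ, CS.add_self]⟩
  obtain ⟨c, d, e, hc, hd, he, e1, e2⟩ := CS.core h1 h2 h3 hsum
  refine ⟨c, d, e, hc, hd, he, e1, e2, ?_⟩
  rw [CS.s2_mul_right hc hd he, ← e1, ← e2]
  exact (CS.eq_of_add hsum).symm
end
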